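/- Let 2 ≤ k ≤ n, α, K₀, N₀, N₁ > 0, let μ ∈ {1,…,k−1}, and let δ_μ ∈ (0,1]. There exist constants ε > 0, δ_{μ+1} > 0, m₀ ∈ ℕ and Λ > 0 (depending on n, k, α, K₀, N₀, N₁, δ_μ) such that the following holds for every integer m ≥ m₀: for every λ ∈ Γ̃_k with λ₁ ≥ λ₂ ≥ ⋯ ≥ λ_n ≥ −K₀, N₀ ≤ S_k(λ) ≤ N₁, λ_μ ≥ δ_μ λ₁, λ_{μ+1} ≤ δ_{μ+1} λ₁, and λ₁ ≥ Λ, and for every ξ ∈ ℝⁿ, with κ_j = λ_j + K₀ and P_m = Σ_j κ_j^m: (P_m²/m)[A₁ + B₁ + C₁ + D₁ − (1 + ε/m)E₁] ≥ (1+ε)(S_k(λ) − κ₁ S_k^{11}(λ))κ₁^{2m−3}ξ₁² + 2P_m Σ_{j≠1} S_k^{jj}(λ) Σ_{l=1}^{m−4} κ_j^{l} κ₁^{m−2−l} ξ_j², where A₁ = (m/P_m)κ₁^{m−1}[2(Σ_p S_k^{pp}(λ)ξ_p)²/S_k(λ) − Σ_{p≠q}S_k^{pp,qq}(λ)ξ_pξ_q],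 B₁ = (2m/P_m)Σ_{j≠1}κ_j^{m−1}S_k^{11,jj}(λ)ξ_j², C₁ = (m(m−1)/P_m)S_k^{11}(λ)Σ_j κ_j^{m−2}ξ_j², D₁ = (2m/P_m)Σ_{j≠1}S_k^{jj}(λ)(Σ_{l=0}^{m−2}κ₁^{m−2−l}κ_j^{l})ξ_j², and E₁ = (m²/P_m²)S_k^{11}(λ)(Σ_j κ_j^{m−1}ξ_j)². -/

import Mathlib

open scoped BigOperators

noncomputable section

/-- The `j`-th elementary symmetric function of the entries of `lam` indexed by `T`
(`j : ℤ`, with value `0` for `j < 0`). -/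
def sigmaOn {n : ℕ} (T : Finset (Fin n)) (j : ℤ) (lam : Fin n → ℝ) : ℝ :=
  if 0 ≤ j then ∑ s ∈ T.powersetCard j.toNat, ∏ i ∈ s, lam i else 0

/-- The `j`-th elementary symmetric polynomial `σ_j(λ)`. -/
def esymmR {n : ℕ} (j : ℤ) (lam : Fin n → ℝ) : ℝ := sigmaOn Finset.univ j lam

/-- The Garding cone `Γ_k`. -/
def GammaCone (n k : ℕ) : Set (Fin n → ℝ) :=
  {lam | ∀ i : ℕ, 1 ≤ i → i ≤ k → 0 < esymmR (i : ℤ) lam}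

/-- `S_j(λ) = σ_j(λ) + α σ_{j-1}(λ)`. -/
def Sfun {n : ℕ} (α : ℝ) (j : ℤ) (lam : Fin n → ℝ) : ℝ :=
  esymmR j lam + α * esymmR (j - 1) lam

/-- The cone `Γ̃_k = Γ_{k-1} ∩ {λ : S_k(λ) > 0}`. -/
def GammaTilde (n k : ℕ) (α : ℝ) : Set (Fin n → ℝ) :=
  GammaCone n (k - 1) ∩ {lam | 0 < Sfun α (k : ℤ) lam}

/-- `S_k^{pp}(λ) = σ_{k-1}(λ|p) + α σ_{k-2}(λ|p)`, where `(λ|p)` deletes the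
`p`-th entry of `λ`. -/
def SD {n : ℕ} (α : ℝ) (k : ℤ) (lam : Fin n → ℝ) (p : Fin n) : ℝ :=
  sigmaOn (Finset.univ.erase p) (k - 1) lam + α * sigmaOn (Finset.univ.erase p) (k - 2) lam

/-- `S_k^{pp,qq}(λ) = σ_{k-2}(λ|pq) + α σ_{k-3}(λ|pq)` for `p ≠ q`, where `(λ|pq)`
deletes the `p`-th and `q`-th entries of `λ`. -/
def SDD {n : ℕ} (α : ℝ) (k : ℤ) (lam : Fin n → ℝ) (p q : Fin n) : ℝ :=
  sigmaOn ((Finset.univ.erase p).erase q) (k - 2) lam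
    + α * sigmaOn ((Finset.univ.erase p).erase q) (k - 3) lam

/-- `P_m = Σ_j κ_j^m` with `κ_j = λ_j + K₀`. -/
def Pm {n : ℕ} (K₀ : ℝ) (m : ℕ) (lam : Fin n → ℝ) : ℝ :=
  ∑ j, (lam j + K₀) ^ m

/-- `A_i = (m/P_m) κ_i^{m-1} [2(Σ_p S_k^{pp} ξ_p)²/S_k − Σ_{p≠q} S_k^{pp,qq} ξ_p ξ_q]`. -/
def Aterm {n : ℕ} (α K₀ : ℝ) (k : ℤ) (m : ℕ) (lam ξ : Fin n → ℝ) (i : Fin n) : ℝ :=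
  ((m : ℝ) / Pm K₀ m lam) * (lam i + K₀) ^ (m - 1) *
    (2 * (∑ p, SD α k lam p * ξ p) ^ 2 / Sfun α k lam
      - ∑ p, ∑ q ∈ Finset.univ.erase p, SDD α k lam p q * ξ p * ξ q)

/-- `B_i = (2m/P_m) Σ_{j≠i} κ_j^{m-1} S_k^{ii,jj} ξ_j²`. -/
def Bterm {n : ℕ} (α K₀ : ℝ) (k : ℤ) (m : ℕ) (lam ξ : Fin n → ℝ) (i : Fin n) : ℝ :=
  (2 * (m : ℝ) / Pm K₀ m lam) *
    ∑ j ∈ Finset.univ.erase i, (lam j + K₀) ^ (m - 1) * SDD α k lam i j * (ξ j) ^ 2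

/-- `C_i = (m(m-1)/P_m) S_k^{ii} Σ_j κ_j^{m-2} ξ_j²`. -/
def Cterm {n : ℕ} (α K₀ : ℝ) (k : ℤ) (m : ℕ) (lam ξ : Fin n → ℝ) (i : Fin n) : ℝ :=
  ((m : ℝ) * ((m : ℝ) - 1) / Pm K₀ m lam) * SD α k lam i *
    ∑ j, (lam j + K₀) ^ (m - 2) * (ξ j) ^ 2

/-- `D_i = (2m/P_m) Σ_{j≠i} S_k^{jj} (Σ_{l=0}^{m-2} κ_i^{m-2-l} κ_j^l) ξ_j²`. -/
def Dterm {n : ℕ} (α K₀ : ℝ) (k : ℤ) (m : ℕ) (lam ξ : Fin n → ℝ) (i : Fin n) : ℝ :=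
  (2 * (m : ℝ) / Pm K₀ m lam) *
    ∑ j ∈ Finset.univ.erase i, SD α k lam j *
      (∑ l ∈ Finset.range (m - 1), (lam i + K₀) ^ (m - 2 - l) * (lam j + K₀) ^ l) * (ξ j) ^ 2

/-- `E_i = (m²/P_m²) S_k^{ii} (Σ_j κ_j^{m-1} ξ_j)²`. -/
def Eterm {n : ℕ} (α K₀ : ℝ) (k : ℤ) (m : ℕ) (lam ξ : Fin n → ℝ) (i : Fin n) : ℝ :=
  ((m : ℝ) ^ 2 / (Pm K₀ m lam) ^ 2) * SD α k lam i *
    (∑ j, (lam j + K₀) ^ (m - 1) * ξ j) ^ 2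

section GenericSymm

variable {ι R : Type*} [DecidableEq ι] [CommRing R]

/-- Elementary symmetric function with integer index over a commutative ring. -/
def EE (T : Finset ι) (j : ℤ) (x : ι → R) : R :=
  if 0 ≤ j then ∑ s ∈ T.powersetCard j.toNat, ∏ i ∈ s, x i else 0

lemma EE_neg (T : Finset ι) {j : ℤ} (hj : j < 0) (x : ι → R) : EE T j x = 0 := by
  simp [EE, not_le.mpr hj]

lemma EE_zero (T : Finset ι) (x : ι → R) : EE T 0 x = 1 := by
  simp [EE]

lemma EE_nat (T : Finset ι) (j : ℕ) (x : ι → R) :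
    EE T (j : ℤ) x = ∑ s ∈ T.powersetCard j, ∏ i ∈ s, x i := by
  simp [EE]

lemma EE_gt_card (T : Finset ι) {j : ℤ} (hj : (T.card : ℤ) < j) (x : ι → R) :
    EE T j x = 0 := by
  have h0 : 0 ≤ j := by omega
  lift j to ℕ using h0
  rw [EE_nat, Finset.powersetCard_eq_empty.mpr (by omega)]
  simp

lemma EE_insert {T : Finset ι} {i : ι} (hi : i ∉ T) (j : ℤ) (x : ι → R) :
    EE (insert i T) j x = EE T j x + x i * EE T (j - 1) x := by
  rcases lt_trichotomy j 0 with hj | hj | hj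
  · rw [EE_neg _ hj, EE_neg _ hj, EE_neg _ (by omega)]; simp
  · subst hj
    rw [EE_zero, EE_zero, EE_neg _ (by omega)]; simp
  · obtain ⟨l, rfl⟩ : ∃ l : ℕ, j = ((l + 1 : ℕ) : ℤ) := ⟨(j - 1).toNat, by omega⟩
    have : (((l + 1 : ℕ) : ℤ) - 1) = (l : ℤ) := by push_cast; ring
    rw [this, EE_nat, EE_nat, EE_nat, Finset.powersetCard_succ_insert hi,
      Finset.sum_union, Finset.sum_image, Finset.mul_sum]
    · congr 1
      apply Finset.sum_congr rfl
      intro s hs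
      rw [Finset.prod_insert]
      intro h
      exact hi ((Finset.mem_powersetCard.mp hs).1 h)
    · intro s hs t ht hst
      have hs' : i ∉ s := fun h => hi ((Finset.mem_powersetCard.mp hs).1 h)
      have ht' : i ∉ t := fun h => hi ((Finset.mem_powersetCard.mp ht).1 h)
      rw [← Finset.erase_insert hs', ← Finset.erase_insert ht', hst]
    · rw [Finset.disjoint_left]
      intro s hs hs2
      obtain ⟨t, ht, rfl⟩ := Finset.mem_image.mp hs2
      exact hi ((Finset.mem_powersetCard.mp hs).1 (Finset.mem_insert_self _ _))

lemma EE_erase {T : Finset ι} {i : ι} (hi : i ∈ T) (j : ℤ) (x : ι → R) :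
    EE T j x = EE (T.erase i) j x + x i * EE (T.erase i) (j - 1) x := by
  conv_lhs => rw [← Finset.insert_erase hi]
  exact EE_insert (Finset.notMem_erase i T) j x

/-- First derivative in the direction `ξ`. -/
def EE1 (T : Finset ι) (j : ℤ) (x ξ : ι → R) : R :=
  ∑ p ∈ T, ξ p * EE (T.erase p) (j - 1) x

/-- Second derivative in the direction `ξ`. -/
def EE2 (T : Finset ι) (j : ℤ) (x ξ : ι → R) : R :=
  ∑ p ∈ T, ξ p * EE1 (T.erase p) (j - 1) x ξ

lemma erase_insert_comm {T : Finset ι} {i p : ι} (hi : i ∉ T) (hp : p ∈ T) :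
    (insert i T).erase p = insert i (T.erase p) := by
  have : i ≠ p := fun h => hi (h ▸ hp)
  exact Finset.erase_insert_of_ne this

lemma EE1_insert {T : Finset ι} {i : ι} (hi : i ∉ T) (j : ℤ) (x ξ : ι → R) :
    EE1 (insert i T) j x ξ = EE1 T j x ξ + x i * EE1 T (j - 1) x ξ + ξ i * EE T (j - 1) x := by
  unfold EE1
  rw [Finset.sum_insert hi, Finset.erase_insert hi, Finset.mul_sum, add_comm,
    ← Finset.sum_add_distrib]
  congr 1
  apply Finset.sum_congr rfl
  intro p hp
  rw [erase_insert_comm hi hp, EE_insert (fun h => hi (Finset.mem_of_mem_erase h))]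
  ring

lemma EE2_insert {T : Finset ι} {i : ι} (hi : i ∉ T) (j : ℤ) (x ξ : ι → R) :
    EE2 (insert i T) j x ξ = EE2 T j x ξ + x i * EE2 T (j - 1) x ξ
      + 2 * (ξ i * EE1 T (j - 1) x ξ) := by
  have h1 : ∑ p ∈ T, ξ p * EE1 ((insert i T).erase p) (j - 1) x ξ
      = EE2 T j x ξ + x i * EE2 T (j - 1) x ξ + ξ i * EE1 T (j - 1) x ξ := by
    unfold EE2
    conv_rhs => rw [EE1]
    rw [Finset.mul_sum, Finset.mul_sum, ← Finset.sum_add_distrib, ← Finset.sum_add_distrib]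
    apply Finset.sum_congr rfl
    intro p hp
    rw [erase_insert_comm hi hp, EE1_insert (fun h => hi (Finset.mem_of_mem_erase h))]
    ring
  conv_lhs => rw [EE2]
  rw [Finset.sum_insert hi, Finset.erase_insert hi, h1]
  ring

lemma EE1_self (T : Finset ι) (j : ℤ) (x : ι → R) :
    EE1 T j x x = (j : R) * EE T j x := by
  induction T using Finset.induction_on generalizing j with
  | empty =>
    simp only [EE1, Finset.sum_empty]
    rcases eq_or_ne j 0 with rfl | h
    · simp
    · rcases lt_or_gt_of_ne h with h | h
      · rw [EE_neg _ h]; simp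
      · rw [EE_gt_card _ (by simpa using h)]; simp
  | insert i T hi ih =>
    rw [EE1_insert hi, ih, ih, EE_insert hi]
    push_cast
    ring

lemma EE_map {S : Type*} [CommRing S] (f : R →+* S) (T : Finset ι) (j : ℤ) (x : ι → R) :
    f (EE T j x) = EE T j (fun i => f (x i)) := by
  unfold EE
  split_ifs <;> simp

end GenericSymm

section Newton

open Polynomial

lemma splits_derivative_real {p : ℝ[X]} (hp : p.Splits) : (derivative p).Splits := by
  rw [splits_iff_card_roots]
  apply le_antisymm (card_roots' _)
  have h1 := card_roots_le_derivative p
  have h2 := hp.natDegree_eq_card_roots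
  have h3 := natDegree_derivative_le p
  omega

lemma laguerre_real {p : ℝ[X]} (hp : p.Splits) (t : ℝ) :
    p.eval t * (derivative (derivative p)).eval t ≤ ((derivative p).eval t) ^ 2 := by
  rw [splits_iff_exists_multiset] at hp
  obtain ⟨m, hm⟩ := hp
  have key : ∀ m : Multiset ℝ, ((m.map (X - C ·)).prod).eval t *
      (derivative (derivative ((m.map (X - C ·)).prod))).eval t
        ≤ ((derivative ((m.map (X - C ·)).prod)).eval t) ^ 2 := by
    intro m
    induction m using Multiset.induction_on with
    | empty => simp
    | cons a m ih =>
      simp only [Multiset.map_cons, Multiset.prod_cons]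
      set q := (m.map (X - C ·)).prod
      simp only [derivative_mul, derivative_sub, derivative_X, derivative_C, sub_zero, one_mul,
        derivative_add, eval_add, eval_mul, eval_sub, eval_X, eval_C]
      nlinarith [mul_nonneg (sq_nonneg (t - a)) (sub_nonneg.mpr ih), sq_nonneg (eval t q)]
  rw [hm]
  simp only [derivative_C_mul, eval_mul, eval_C]
  nlinarith [mul_nonneg (sq_nonneg p.leadingCoeff) (sub_nonneg.mpr (key m))]

variable {ι : Type*} [DecidableEq ι]

lemma coeff_prod_EE (T : Finset ι) (x : ι → ℝ) (j : ℕ) :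
    (∏ i ∈ T, (1 + C (x i) * X)).coeff j = EE T (j : ℤ) x := by
  induction T using Finset.induction_on generalizing j with
  | empty =>
    rcases Nat.eq_zero_or_pos j with rfl | h
    · simp [EE_zero]
    · rw [EE_gt_card _ (by simpa using h)]
      simp [coeff_one, h.ne']
  | insert i T hi ih =>
    rw [Finset.prod_insert hi, EE_insert hi, add_mul, one_mul, coeff_add, ih]
    congr 1
    rw [mul_assoc, coeff_C_mul]
    congr 1
    cases j with
    | zero => simp [EE_neg]
    | succ l => rw [coeff_X_mul, ih]; push_cast; simp

lemma iterate_derivative_splits {p : ℝ[X]} (hp : p.Splits) (l : ℕ) :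
    (derivative^[l] p).Splits := by
  induction l with
  | zero => simpa
  | succ l ih => rw [Function.iterate_succ_apply']; exact splits_derivative_real ih

/-- Weak Newton inequality. -/
lemma EE_newton (T : Finset ι) (x : ι → ℝ) (j : ℤ) :
    EE T (j + 1) x * EE T (j - 1) x ≤ (EE T j x) ^ 2 := by
  rcases lt_or_ge (j - 1) 0 with h | h
  · rw [EE_neg _ h]; simp; positivity
  obtain ⟨l, hl⟩ : ∃ l : ℕ, j = (l : ℤ) + 1 := ⟨(j - 1).toNat, by omega⟩
  subst hl
  set p : ℝ[X] := ∏ i ∈ T, (1 + C (x i) * X) with hp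
  have hs : p.Splits := by
    rw [hp]
    apply Splits.prod
    intro i _
    apply Splits.of_natDegree_le_one
    compute_degree
  have hL := laguerre_real (iterate_derivative_splits hs l) 0
  have e0 : (derivative^[l] p).eval 0 = (l.factorial : ℝ) * EE T (l : ℤ) x := by
    rw [← coeff_zero_eq_eval_zero, coeff_iterate_derivative, zero_add, coeff_prod_EE,
      Nat.descFactorial_self]; simp
  have e1 : (derivative (derivative^[l] p)).eval 0
      = ((l+1).factorial : ℝ) * EE T ((l : ℤ) + 1) x := by
    rw [← Function.iterate_succ_apply' (f := derivative), ← coeff_zero_eq_eval_zero,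
      coeff_iterate_derivative, zero_add, coeff_prod_EE, Nat.descFactorial_self]; simp
  have e2 : (derivative (derivative (derivative^[l] p))).eval 0
      = ((l+2).factorial : ℝ) * EE T ((l : ℤ) + 1 + 1) x := by
    rw [← Function.iterate_succ_apply' (f := derivative),
      ← Function.iterate_succ_apply' (f := derivative), ← coeff_zero_eq_eval_zero,
      coeff_iterate_derivative, zero_add, coeff_prod_EE, Nat.descFactorial_self]
    simp [add_assoc]
  rw [e0, e1, e2] at hL
  have f1 : ((l+1).factorial : ℝ) = (l + 1) * l.factorial := by
    rw [Nat.factorial_succ]; push_cast; ring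
  have f2 : ((l+2).factorial : ℝ) = (l + 2) * ((l + 1) * l.factorial) := by
    rw [Nat.factorial_succ, Nat.factorial_succ]; push_cast; ring
  rw [f1, f2] at hL
  have hf : (0 : ℝ) < l.factorial := by exact_mod_cast l.factorial_pos
  simp only [add_sub_cancel_right]
  set a := EE T (l : ℤ) x
  set b := EE T ((l : ℤ) + 1) x
  set c := EE T ((l : ℤ) + 1 + 1) x
  have hl0 : (0 : ℝ) ≤ l := by positivity
  have h2 : ((l : ℝ) + 2) * (c * a) ≤ (l + 1) * b ^ 2 := by
    have hpos : (0 : ℝ) < (l.factorial : ℝ) ^ 2 * (l + 1) := by positivity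
    refine le_of_mul_le_mul_left ?_ hpos
    nlinarith [hL]
  rcases le_or_gt (c * a) 0 with h3 | h3
  · nlinarith [sq_nonneg b]
  · nlinarith [sq_nonneg b]

end Newton

section Cone

variable {ι : Type*} [DecidableEq ι]

/-- The Garding cone condition on the index set `T`. -/
def Cone (T : Finset ι) (k : ℤ) (x : ι → ℝ) : Prop :=
  ∀ j : ℤ, 0 ≤ j → j ≤ k → 0 < EE T j x

lemma Cone.mono {T : Finset ι} {k l : ℤ} {x : ι → ℝ} (h : Cone T k x) (hl : l ≤ k) :
    Cone T l x := fun j h0 hj => h j h0 (hj.trans hl)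

lemma Cone.nonneg {T : Finset ι} {k : ℤ} {x : ι → ℝ} (h : Cone T k x) {j : ℤ} (hj : j ≤ k) :
    0 ≤ EE T j x := by
  rcases lt_or_ge j 0 with h0 | h0
  · rw [EE_neg _ h0]
  · exact (h j h0 hj).le

lemma Cone.erase {T : Finset ι} {k : ℤ} {x : ι → ℝ} (h : Cone T k x) {i : ι} (hi : i ∈ T) :
    Cone (T.erase i) (k - 1) x := by
  have key : ∀ j : ℕ, (j : ℤ) ≤ k - 1 → 0 < EE (T.erase i) (j : ℤ) x := by
    intro j
    induction j with
    | zero => intro _; simp [EE_zero]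
    | succ j ih =>
      intro hj
      push_cast at hj ⊢
      have h0 := ih (by omega)
      by_contra hc
      push Not at hc
      have h1 := h ((j : ℤ) + 1) (by omega) (by omega)
      have h2 := h ((j : ℤ) + 1 + 1) (by omega) (by omega)
      rw [EE_erase hi] at h1 h2
      rw [add_sub_cancel_right] at h1 h2
      have hN := EE_newton (T.erase i) x ((j : ℤ) + 1)
      rw [add_sub_cancel_right] at hN
      set a := EE (T.erase i) (j : ℤ) x
      set b := EE (T.erase i) ((j : ℤ) + 1) x
      set c := EE (T.erase i) ((j : ℤ) + 1 + 1) x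
      have h3 : 0 < (c + x i * b) * a := mul_pos h2 h0
      have h4 : 0 ≤ (b + x i * a) * (-b) := mul_nonneg h1.le (by linarith)
      nlinarith
  intro j h0 hj
  lift j to ℕ using h0
  exact key j hj

lemma quot_bound (B : Finset ι) (k : ℤ) (hB : (B.card : ℤ) < k) (x : ι → ℝ) (θ : ℝ) (hθ : 0 ≤ θ)
    (T : Finset ι) (hx : ∀ i ∈ T, i ∉ B → x i ≤ θ) (hT : Cone T k x) :
    EE T k x ≤ ((T \ B).card : ℝ) * θ * EE T (k - 1) x := by
  induction T using Finset.strongInduction with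
  | H T ih =>
    rcases (T \ B).eq_empty_or_nonempty with he | ⟨q, hq⟩
    · exfalso
      have hsub : T ⊆ B := Finset.sdiff_eq_empty_iff_subset.mp he
      have hc := Finset.card_le_card hsub
      have := hT k (by omega) le_rfl
      rw [EE_gt_card _ (by omega)] at this
      exact lt_irrefl _ this
    · obtain ⟨hqT, hqB⟩ := Finset.mem_sdiff.mp hq
      have hcone := hT.erase hqT
      have hk0 : 0 ≤ k - 1 := by omega
      have c1 : 0 < EE (T.erase q) (k - 1) x := hcone _ hk0 le_rfl
      have c2 : 0 ≤ EE (T.erase q) (k - 1 - 1) x := hcone.nonneg (by omega)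
      have a1 : 0 < EE T (k - 1) x := hT _ hk0 (by omega)
      have hN := EE_newton (T.erase q) x (k - 1)
      rw [sub_add_cancel] at hN
      have hM : ((T \ B).card : ℝ) = (((T.erase q) \ B).card : ℝ) + 1 := by
        rw [Finset.erase_sdiff_comm, Finset.card_erase_of_mem hq]
        have : 0 < (T \ B).card := Finset.card_pos.mpr ⟨q, hq⟩
        rw [Nat.cast_sub this]; simp
      have hck : EE (T.erase q) k x ≤ (((T.erase q) \ B).card : ℝ) * θ * EE (T.erase q) (k-1) x := by
        rcases le_or_gt (EE (T.erase q) k x) 0 with h | h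
        · exact h.trans (by positivity)
        · apply ih _ (Finset.erase_ssubset hqT) (fun i hi => hx i (Finset.mem_of_mem_erase hi))
          intro j h0 hj
          rcases eq_or_lt_of_le hj with rfl | hj
          · exact h
          · exact hcone j h0 (by omega)
      have hxq := hx q hqT hqB
      rw [EE_erase hqT (k - 1)] at a1 ⊢
      rw [EE_erase hqT k, hM]
      set M : ℝ := (((T.erase q) \ B).card : ℝ)
      have hM0 : 0 ≤ M := by positivity
      set a := EE (T.erase q) (k - 1 - 1) x
      set b := EE (T.erase q) (k - 1) x
      set c := EE (T.erase q) k x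
      have hd : 0 < b + θ * a := by positivity
      have h1 : 0 ≤ (θ - x q) * (b ^ 2 - c * a) :=
        mul_nonneg (by linarith) (by linarith)
      have h2 : c + θ * b ≤ (M + 1) * θ * (b + θ * a) := by
        have : 0 ≤ (M + 1) * θ * (θ * a) := by positivity
        nlinarith
      have h3 : (c + θ * b) * (b + x q * a) ≤ (M + 1) * θ * (b + θ * a) * (b + x q * a) :=
        mul_le_mul_of_nonneg_right h2 a1.le
      refine le_of_mul_le_mul_right ?_ hd
      nlinarith

lemma quot_bound' (B : Finset ι) (k : ℤ) (hB : (B.card : ℤ) < k) (x : ι → ℝ) (θ : ℝ) (hθ : 0 ≤ θ)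
    (T : Finset ι) (hx : ∀ i ∈ T, i ∉ B → x i ≤ θ) (hT : Cone T k x) {q : ι} (hqT : q ∈ T)
    (hqB : q ∉ B) :
    EE T k x ≤ ((T.card : ℝ) + 1) * θ * EE (T.erase q) (k - 1) x := by
  have hcone := hT.erase hqT
  have c1 : 0 < EE (T.erase q) (k - 1) x := hcone _ (by omega) le_rfl
  have h1 : EE (T.erase q) k x ≤ (T.card : ℝ) * θ * EE (T.erase q) (k - 1) x := by
    rcases le_or_gt (EE (T.erase q) k x) 0 with h | h
    · exact h.trans (by positivity)
    · have := quot_bound B k hB x θ hθ (T.erase q)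
        (fun i hi => hx i (Finset.mem_of_mem_erase hi)) (by
          intro j h0 hj
          rcases eq_or_lt_of_le hj with rfl | hj
          · exact h
          · exact hcone j h0 (by omega))
      refine this.trans ?_
      have hc : (((T.erase q) \ B).card : ℝ) ≤ (T.card : ℝ) := by
        exact_mod_cast Finset.card_le_card
          (Finset.sdiff_subset.trans (Finset.erase_subset _ _))
      gcongr
  rw [EE_erase hqT k]
  have := mul_le_mul_of_nonneg_right (hx q hqT hqB) c1.le
  nlinarith

end Cone

section Concave

open PowerSeries

variable {ι : Type*} [DecidableEq ι]

/-- The line `x + t ξ` as a family of power series. -/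
def lineP (x ξ : ι → ℝ) (i : ι) : PowerSeries ℝ := C (x i) + C (ξ i) * X

lemma lineP_mul0 (x ξ : ι → ℝ) (i : ι) (f : PowerSeries ℝ) :
    coeff 0 (lineP x ξ i * f) = x i * coeff 0 f := by
  simp [lineP]

lemma lineP_mul_succ (x ξ : ι → ℝ) (i : ι) (f : PowerSeries ℝ) (l : ℕ) :
    coeff (l + 1) (lineP x ξ i * f) = x i * coeff (l + 1) f + ξ i * coeff l f := by
  rw [lineP, add_mul, map_add, coeff_C_mul, mul_assoc, coeff_C_mul, coeff_succ_X_mul]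

lemma EE_empty {R : Type*} [CommRing R] (j : ℤ) (x : ι → R) :
    EE (∅ : Finset ι) j x = if j = 0 then 1 else 0 := by
  split_ifs with h
  · subst h; exact EE_zero _ _
  · rcases lt_or_gt_of_ne h with h | h
    · exact EE_neg _ h _
    · exact EE_gt_card _ (by simpa using h) _

lemma coeff_EE_lineP (T : Finset ι) (x ξ : ι → ℝ) (j : ℤ) :
    coeff 0 (EE T j (lineP x ξ)) = EE T j x ∧
    coeff 1 (EE T j (lineP x ξ)) = EE1 T j x ξ ∧
    2 * coeff 2 (EE T j (lineP x ξ)) = EE2 T j x ξ := by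
  induction T using Finset.induction_on generalizing j with
  | empty =>
    rw [EE_empty, EE_empty]
    split_ifs <;> simp [EE1, EE2, coeff_one]
  | insert i T hi ih =>
    rw [EE_insert hi, EE_insert hi, EE1_insert hi, EE2_insert hi]
    obtain ⟨h0, h1, h2⟩ := ih j
    obtain ⟨g0, g1, g2⟩ := ih (j - 1)
    refine ⟨?_, ?_, ?_⟩
    · rw [map_add, lineP_mul0, h0, g0]
    · rw [map_add, lineP_mul_succ x ξ i _ 0, h1, g0, zero_add, g1]; ring
    · rw [map_add, lineP_mul_succ x ξ i _ 1, mul_add, h2, g1]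
      rw [show (1 : ℕ) + 1 = 2 from rfl, ← g2]; ring

lemma coeff0_mul (f g : PowerSeries ℝ) : coeff 0 (f * g) = coeff 0 f * coeff 0 g := by
  simp

lemma coeff1_mul (f g : PowerSeries ℝ) :
    coeff 1 (f * g) = coeff 0 f * coeff 1 g + coeff 1 f * coeff 0 g := by
  rw [coeff_mul, Finset.Nat.antidiagonal_succ]; simp

lemma coeff2_mul (f g : PowerSeries ℝ) :
    coeff 2 (f * g) = coeff 0 f * coeff 2 g + coeff 1 f * coeff 1 g + coeff 2 f * coeff 0 g := by
  rw [coeff_mul, Finset.Nat.sum_antidiagonal_eq_sum_range_succ (fun i j => coeff i f * coeff j g)]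
  simp [Finset.sum_range_succ]

lemma quad_over_lin (X Y Z : PowerSeries ℝ) (hX : coeff 2 X = 0) (hY : 0 < coeff 0 Y)
    (hY2 : coeff 2 Y ≤ 0) (h : Z * Y = X * X) : 0 ≤ coeff 2 Z := by
  have h0 := congrArg (coeff 0) h
  have h1 := congrArg (coeff 1) h
  have h2 := congrArg (coeff 2) h
  rw [coeff0_mul, coeff0_mul] at h0
  rw [coeff1_mul, coeff1_mul] at h1
  rw [coeff2_mul, coeff2_mul, hX] at h2
  set x0 := coeff 0 X
  set x1 := coeff 1 X
  set y0 := coeff 0 Y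
  set y1 := coeff 1 Y
  set y2 := coeff 2 Y
  set z0 := coeff 0 Z
  set z1 := coeff 1 Z
  set z2 := coeff 2 Z
  have hz0 : z0 = x0 ^ 2 / y0 := by field_simp; linarith
  have hz1 : z1 = (2 * x0 * x1 - z0 * y1) / y0 := by field_simp; linarith
  have hz2 : z2 = (x1 ^ 2 - z0 * y2 - z1 * y1) / y0 := by field_simp; linarith
  have e : x1 ^ 2 - z0 * y2 - z1 * y1 = (x1 - x0 * y1 / y0) ^ 2 + (x0 ^ 2 / y0) * (-y2) := by
    rw [hz1, hz0]; field_simp; ring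
  rw [hz2, e]
  have : 0 ≤ -y2 := by linarith
  positivity

lemma exists_quot (f g : PowerSeries ℝ) (h : coeff 0 g ≠ 0) : ∃ q, q * g = f := by
  refine ⟨f * g⁻¹, ?_⟩
  rw [mul_assoc, PowerSeries.inv_mul_cancel g (by simpa using h), mul_one]

/-- Concavity of `σ_{k+1}/σ_k` (Marcus–Lopes), second order version. -/
lemma quot_concave (x ξ : ι → ℝ) (k : ℕ) : ∀ T : Finset ι, Cone T ((k : ℤ) + 1) x →
    ∀ q : PowerSeries ℝ, q * EE T (k : ℤ) (lineP x ξ) = EE T ((k : ℤ) + 1) (lineP x ξ) →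
      coeff 2 q ≤ 0 := by
  induction k with
  | zero =>
    intro T _ q hq
    simp only [Nat.cast_zero, EE_zero, mul_one, zero_add] at hq
    rw [hq]
    have := (coeff_EE_lineP T x ξ 1).2.2
    have h0 : EE2 T 1 x ξ = 0 := by
      unfold EE2 EE1
      apply Finset.sum_eq_zero
      intro p _
      rw [Finset.sum_eq_zero, mul_zero]
      intro r _
      rw [EE_neg _ (by norm_num), mul_zero]
    linarith
  | succ k ih =>
    intro T hT q hq
    push_cast at hT hq
    have hex : ∀ i ∈ T, ∃ Z : PowerSeries ℝ, 0 ≤ coeff 2 Z ∧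
        Z * EE T ((k : ℤ) + 1) (lineP x ξ)
          = lineP x ξ i * lineP x ξ i * EE (T.erase i) (k : ℤ) (lineP x ξ) := by
      intro i hi
      have hc := hT.erase hi
      rw [add_sub_cancel_right] at hc
      have hA : 0 < coeff 0 (EE (T.erase i) (k : ℤ) (lineP x ξ)) := by
        rw [(coeff_EE_lineP _ x ξ _).1]; exact hc _ (by omega) (by omega)
      have hA' : 0 < coeff 0 (EE T ((k : ℤ) + 1) (lineP x ξ)) := by
        rw [(coeff_EE_lineP _ x ξ _).1]; exact hT _ (by omega) (by omega)
      obtain ⟨qi, hqi⟩ := exists_quot (EE (T.erase i) ((k : ℤ) + 1) (lineP x ξ)) _ hA.ne'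
      have h2 := ih _ hc qi hqi
      set Y := lineP x ξ i + qi with hY
      have hYA : Y * EE (T.erase i) (k : ℤ) (lineP x ξ) = EE T ((k : ℤ) + 1) (lineP x ξ) := by
        rw [EE_erase hi ((k : ℤ) + 1), add_sub_cancel_right, hY, add_mul, hqi, add_comm]
      have hY0 : 0 < coeff 0 Y := by
        have := congrArg (coeff 0) hYA
        rw [coeff0_mul] at this
        rw [← this] at hA'
        exact pos_of_mul_pos_left hA' hA.le
      have hl2 : coeff 2 (lineP x ξ i) = 0 := by
        have := lineP_mul_succ x ξ i 1 1
        simpa [coeff_one] using this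
      have hY2 : coeff 2 Y ≤ 0 := by
        rw [hY, map_add, hl2, zero_add]; exact h2
      obtain ⟨Z, hZ⟩ := exists_quot (lineP x ξ i * lineP x ξ i) Y hY0.ne'
      refine ⟨Z, quad_over_lin _ Y Z hl2 hY0 hY2 hZ, ?_⟩
      rw [← hYA, ← mul_assoc, hZ]
    choose! Z hZ0 hZ using hex
    set Bk := EE T ((k : ℤ) + 1) (lineP x ξ) with hBk
    have hB : 0 < coeff 0 Bk := by
      rw [hBk, (coeff_EE_lineP _ x ξ _).1]; exact hT _ (by omega) (by omega)
    have hB' : Bk ≠ 0 := by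
      intro h; rw [h] at hB; simp at hB
    have hE := EE1_self T ((k : ℤ) + 1 + 1) (lineP x ξ)
    rw [← hq, EE1, add_sub_cancel_right] at hE
    have hmain : (((k : ℤ) + 1 + 1 : ℤ) : PowerSeries ℝ) * q
        = ∑ i ∈ T, (lineP x ξ i - Z i) := by
      apply mul_right_cancel₀ hB'
      rw [mul_assoc, ← hE, Finset.sum_mul]
      apply Finset.sum_congr rfl
      intro i hi
      rw [sub_mul, hZ i hi]
      have := EE_erase hi ((k : ℤ) + 1) (lineP x ξ)
      rw [add_sub_cancel_right, ← hBk] at this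
      rw [this]; ring
    have hc2 := congrArg (coeff 2) hmain
    rw [map_sum] at hc2
    have hr : ∑ i ∈ T, coeff 2 (lineP x ξ i - Z i) ≤ 0 := by
      apply Finset.sum_nonpos
      intro i hi
      have hl2 : coeff 2 (lineP x ξ i) = 0 := by
        have := lineP_mul_succ x ξ i 1 1
        simpa [coeff_one] using this
      rw [map_sub, hl2]
      linarith [hZ0 i hi]
    rw [← hc2] at hr
    have hcast : (((k : ℤ) + 1 + 1 : ℤ) : PowerSeries ℝ) = C ((k : ℝ) + 1 + 1) := by
      push_cast; simp
    rw [hcast, coeff_C_mul] at hr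
    have : (0 : ℝ) < (k : ℝ) + 1 + 1 := by positivity
    by_contra hcon
    push Not at hcon
    have := mul_pos this hcon
    linarith

/-- Logarithmic form of the concavity of `σ_{k+1}/σ_k`. -/
lemma log_step (x ξ : ι → ℝ) (k : ℕ) (T : Finset ι) (hT : Cone T ((k : ℤ) + 1) x) :
    (EE2 T ((k : ℤ) + 1) x ξ / EE T ((k : ℤ) + 1) x
        - (EE1 T ((k : ℤ) + 1) x ξ / EE T ((k : ℤ) + 1) x) ^ 2)
      - (EE2 T (k : ℤ) x ξ / EE T (k : ℤ) x - (EE1 T (k : ℤ) x ξ / EE T (k : ℤ) x) ^ 2)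
      + (EE1 T ((k : ℤ) + 1) x ξ / EE T ((k : ℤ) + 1) x
        - EE1 T (k : ℤ) x ξ / EE T (k : ℤ) x) ^ 2 ≤ 0 := by
  obtain ⟨h0, h1, h2⟩ := coeff_EE_lineP T x ξ (k : ℤ)
  obtain ⟨g0, g1, g2⟩ := coeff_EE_lineP T x ξ ((k : ℤ) + 1)
  have p0 : 0 < EE T (k : ℤ) x := hT _ (by omega) (by omega)
  have p1 : 0 < EE T ((k : ℤ) + 1) x := hT _ (by omega) (by omega)
  obtain ⟨q, hq⟩ := exists_quot (EE T ((k : ℤ) + 1) (lineP x ξ)) (EE T (k : ℤ) (lineP x ξ))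
    (by rw [h0]; exact p0.ne')
  have hq2 := quot_concave x ξ k T hT q hq
  have c0 := congrArg (coeff 0) hq
  have c1 := congrArg (coeff 1) hq
  have c2 := congrArg (coeff 2) hq
  rw [coeff0_mul, h0, g0] at c0
  rw [coeff1_mul, h0, h1, g1] at c1
  rw [coeff2_mul, h0, h1] at c2
  set a := EE T (k : ℤ) x
  set a' := EE T ((k : ℤ) + 1) x
  set b := EE1 T (k : ℤ) x ξ
  set b' := EE1 T ((k : ℤ) + 1) x ξ
  rw [← h2, ← g2]
  set c := coeff 2 (EE T (k : ℤ) (lineP x ξ))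
  set c' := coeff 2 (EE T ((k : ℤ) + 1) (lineP x ξ))
  set q0 := coeff 0 q
  set q1 := coeff 1 q
  set q2 := coeff 2 q
  have hq0 : 0 < q0 := by
    rw [← c0] at p1
    exact pos_of_mul_pos_left p1 p0.le
  have : (2 * c' / a' - (b' / a') ^ 2) - (2 * c / a - (b / a) ^ 2) + (b' / a' - b / a) ^ 2
      = 2 * q2 / q0 := by
    rw [← c0, ← c1, ← c2]
    field_simp
    ring
  rw [this]
  exact div_nonpos_of_nonpos_of_nonneg (by linarith) hq0.le

lemma log_chain (x ξ : ι → ℝ) (μ d : ℕ) (T : Finset ι)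
    (hT : Cone T ((μ : ℤ) + (d + 1 : ℕ)) x) :
    (EE2 T ((μ : ℤ) + (d + 1 : ℕ)) x ξ / EE T ((μ : ℤ) + (d + 1 : ℕ)) x
        - (EE1 T ((μ : ℤ) + (d + 1 : ℕ)) x ξ / EE T ((μ : ℤ) + (d + 1 : ℕ)) x) ^ 2)
      - (EE2 T (μ : ℤ) x ξ / EE T (μ : ℤ) x - (EE1 T (μ : ℤ) x ξ / EE T (μ : ℤ) x) ^ 2)
      + (EE1 T ((μ : ℤ) + (d + 1 : ℕ)) x ξ / EE T ((μ : ℤ) + (d + 1 : ℕ)) x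
        - EE1 T (μ : ℤ) x ξ / EE T (μ : ℤ) x) ^ 2 / ((d : ℝ) + 1) ≤ 0 := by
  induction d with
  | zero =>
    have := log_step x ξ μ T (by simpa using hT)
    simpa using this
  | succ d ih =>
    have e : ((μ : ℤ) + (d + 1 + 1 : ℕ)) = (((μ + (d + 1) : ℕ) : ℤ)) + 1 := by push_cast; ring
    have e' : ((μ : ℤ) + (d + 1 : ℕ)) = ((μ + (d + 1) : ℕ) : ℤ) := by push_cast; ring
    rw [e] at hT
    have h1 := log_step x ξ _ T hT
    have h2 := ih (hT.mono (by push_cast; omega))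
    rw [e]
    rw [e'] at h2
    set u := EE1 T (((μ + (d + 1) : ℕ) : ℤ) + 1) x ξ / EE T (((μ + (d + 1) : ℕ) : ℤ) + 1) x
    set v := EE1 T (((μ + (d + 1) : ℕ) : ℤ)) x ξ / EE T (((μ + (d + 1) : ℕ) : ℤ)) x
    set w := EE1 T (μ : ℤ) x ξ / EE T (μ : ℤ) x
    have key : (u - w) ^ 2 / (((d + 1 : ℕ) : ℝ) + 1) ≤ (v - w) ^ 2 / ((d : ℝ) + 1) + (u - v) ^ 2 := by
      have hd : (0 : ℝ) < (d : ℝ) + 1 := by positivity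
      push_cast
      have : (v - w) ^ 2 / ((d : ℝ) + 1) + (u - v) ^ 2 - (u - w) ^ 2 / ((d : ℝ) + 1 + 1)
          = ((v - w) - ((d : ℝ) + 1) * (u - v)) ^ 2 / (((d : ℝ) + 1) * ((d : ℝ) + 1 + 1)) := by
        field_simp
        ring
      have h3 : 0 ≤ ((v - w) - ((d : ℝ) + 1) * (u - v)) ^ 2
          / (((d : ℝ) + 1) * ((d : ℝ) + 1 + 1)) := by positivity
      linarith
    linarith

/-- Consequence: a lower bound for the second order form of the logarithm. -/
lemma log_lower (x ξ : ι → ℝ) (μ k : ℕ) (hμ : μ < k) (T : Finset ι)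
    (hT : Cone T (k : ℤ) x) :
    (1 + 1 / ((k : ℝ) - μ + 1)) * (EE1 T (μ : ℤ) x ξ / EE T (μ : ℤ) x) ^ 2
        - EE2 T (μ : ℤ) x ξ / EE T (μ : ℤ) x
      ≤ 2 * (EE1 T (k : ℤ) x ξ / EE T (k : ℤ) x) ^ 2 - EE2 T (k : ℤ) x ξ / EE T (k : ℤ) x := by
  obtain ⟨d, rfl⟩ : ∃ d : ℕ, k = μ + (d + 1) := ⟨k - μ - 1, by omega⟩
  have h := log_chain x ξ μ d T (by simpa using hT)
  have e' : ((μ : ℤ) + (d + 1 : ℕ)) = ((μ + (d + 1) : ℕ) : ℤ) := by push_cast; ring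
  rw [e'] at h
  set u := EE1 T (((μ + (d + 1) : ℕ) : ℤ)) x ξ / EE T (((μ + (d + 1) : ℕ) : ℤ)) x
  set w := EE1 T (μ : ℤ) x ξ / EE T (μ : ℤ) x
  have hd : (0 : ℝ) < (d : ℝ) + 1 := by positivity
  have hcast : (((μ + (d + 1) : ℕ) : ℝ) - μ + 1) = (d : ℝ) + 1 + 1 := by push_cast; ring
  rw [hcast]
  have key : u ^ 2 + (u - w) ^ 2 / ((d : ℝ) + 1) - 1 / ((d : ℝ) + 1 + 1) * w ^ 2
      = (((d : ℝ) + 1 + 1) * u - w) ^ 2 / (((d : ℝ) + 1) * ((d : ℝ) + 1 + 1)) := by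
    field_simp
    ring
  have h3 : 0 ≤ (((d : ℝ) + 1 + 1) * u - w) ^ 2 / (((d : ℝ) + 1) * ((d : ℝ) + 1 + 1)) := by
    positivity
  linarith

end Concave

section Perturb

variable {ι : Type*} [DecidableEq ι]

lemma abs_prod_le_pow (s : Finset ι) (x : ι → ℝ) (L : ℝ) (h : ∀ i ∈ s, |x i| ≤ L) :
    |∏ i ∈ s, x i| ≤ L ^ s.card := by
  rw [Finset.abs_prod]
  calc ∏ i ∈ s, |x i| ≤ ∏ _i ∈ s, L := Finset.prod_le_prod (fun i _ => abs_nonneg _) h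
    _ = L ^ s.card := by simp

lemma EE_abs_le (T : Finset ι) (x : ι → ℝ) (L : ℝ) (hL : 0 ≤ L) (h : ∀ i ∈ T, |x i| ≤ L) (j : ℕ)
    (N : ℕ) (hN : T.card ≤ N) :
    |EE T (j : ℤ) x| ≤ 2 ^ N * L ^ j := by
  rw [EE_nat]
  calc |∑ s ∈ T.powersetCard j, ∏ i ∈ s, x i|
      ≤ ∑ s ∈ T.powersetCard j, |∏ i ∈ s, x i| := Finset.abs_sum_le_sum_abs _ _
    _ ≤ ∑ _s ∈ T.powersetCard j, L ^ j := by
        apply Finset.sum_le_sum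
        intro s hs
        obtain ⟨h1, h2⟩ := Finset.mem_powersetCard.mp hs
        rw [← h2]
        exact abs_prod_le_pow s x L (fun i hi => h i (h1 hi))
    _ = (T.card.choose j : ℝ) * L ^ j := by simp
    _ ≤ 2 ^ N * L ^ j := by
        have h1 : (T.card.choose j : ℝ) ≤ 2 ^ T.card := by
          exact_mod_cast Nat.choose_le_two_pow _ _
        have h2 : (2 : ℝ) ^ T.card ≤ 2 ^ N := pow_le_pow_right₀ (by norm_num) hN
        have : 0 ≤ L ^ j := by positivity
        exact mul_le_mul_of_nonneg_right (h1.trans h2) this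

lemma EE_sub_prod_le (T B : Finset ι) (hB : B ⊆ T) (x : ι → ℝ) (L η : ℝ) (hL : 0 ≤ L)
    (hη : 0 ≤ η) (h : ∀ i ∈ T, |x i| ≤ L) (h' : ∀ i ∈ T, i ∉ B → |x i| ≤ η * L)
    (N : ℕ) (hN : T.card ≤ N) :
    |EE T (B.card : ℤ) x - ∏ i ∈ B, x i| ≤ 2 ^ N * η * L ^ B.card := by
  rw [EE_nat]
  have hmem : B ∈ T.powersetCard B.card := Finset.mem_powersetCard.mpr ⟨hB, rfl⟩
  rw [← Finset.add_sum_erase _ _ hmem, add_sub_cancel_left]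
  calc |∑ s ∈ (T.powersetCard B.card).erase B, ∏ i ∈ s, x i|
      ≤ ∑ s ∈ (T.powersetCard B.card).erase B, |∏ i ∈ s, x i| := Finset.abs_sum_le_sum_abs _ _
    _ ≤ ∑ _s ∈ (T.powersetCard B.card).erase B, η * L ^ B.card := by
        apply Finset.sum_le_sum
        intro s hs
        obtain ⟨hne, hs⟩ := Finset.mem_erase.mp hs
        obtain ⟨h1, h2⟩ := Finset.mem_powersetCard.mp hs
        have : ∃ v ∈ s, v ∉ B := by
          by_contra hcon
          push Not at hcon
          exact hne (Finset.eq_of_subset_of_card_le hcon h2.ge)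
        obtain ⟨v, hv, hvB⟩ := this
        rw [← Finset.mul_prod_erase _ _ hv, abs_mul]
        have e1 := abs_prod_le_pow (s.erase v) x L
          (fun i hi => h i (h1 (Finset.mem_of_mem_erase hi)))
        have e2 := h' v (h1 hv) hvB
        have e3 : (s.erase v).card + 1 = B.card := by
          rw [Finset.card_erase_add_one hv, h2]
        calc |x v| * |∏ i ∈ s.erase v, x i| ≤ (η * L) * L ^ (s.erase v).card := by
              apply mul_le_mul e2 e1 (abs_nonneg _) (by positivity)
          _ = η * L ^ B.card := by rw [← e3]; ring
    _ = (((T.powersetCard B.card).erase B).card : ℝ) * (η * L ^ B.card) := by simp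
    _ ≤ 2 ^ N * (η * L ^ B.card) := by
        have h1 : (((T.powersetCard B.card).erase B).card : ℝ) ≤ 2 ^ T.card := by
          have a1 : ((T.powersetCard B.card).erase B).card ≤ (T.powersetCard B.card).card :=
            Finset.card_le_card (Finset.erase_subset _ _)
          rw [Finset.card_powersetCard] at a1
          exact_mod_cast a1.trans (Nat.choose_le_two_pow _ _)
        have h2 : (2 : ℝ) ^ T.card ≤ 2 ^ N := pow_le_pow_right₀ (by norm_num) hN
        exact mul_le_mul_of_nonneg_right (h1.trans h2) (by positivity)
    _ = 2 ^ N * η * L ^ B.card := by ring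

variable [Fintype ι]

lemma form_lower (B : Finset ι) (a : ι → ℝ) (r : ι → ℝ) (r2 : ι → ι → ℝ) (c η c0 : ℝ)
    (hc : 0 ≤ c) (hη : 0 ≤ η) (hc0 : 0 ≤ c0) (hc1 : c0 ≤ 1)
    (hr : ∀ p ∈ B, |r p - 1| ≤ c * η) (hr' : ∀ p, p ∉ B → |r p| ≤ c)
    (hr2 : ∀ p ∈ B, ∀ q ∈ B, p ≠ q → |r2 p q - 1| ≤ c * η)
    (hr2' : ∀ p q, p ≠ q → (p ∉ B ∨ q ∉ B) → |r2 p q| ≤ c) :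
    ∑ p ∈ B, a p ^ 2 + c0 * (∑ p ∈ B, a p) ^ 2
      - 5 * c * η * (∑ p ∈ B, |a p|) ^ 2 - 6 * c * (∑ p ∈ B, |a p|) * (∑ p ∈ Bᶜ, |a p|)
      - c * (∑ p ∈ Bᶜ, |a p|) ^ 2
    ≤ (1 + c0) * (∑ p, r p * a p) ^ 2
      - ∑ p, ∑ q ∈ Finset.univ.erase p, r2 p q * a p * a q := by
  set t := ∑ p ∈ B, a p with ht
  set b := ∑ p ∈ B, |a p| with hb
  set v := ∑ p ∈ Bᶜ, |a p| with hv
  have hb0 : 0 ≤ b := Finset.sum_nonneg (fun _ _ => abs_nonneg _)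
  have hv0 : 0 ≤ v := Finset.sum_nonneg (fun _ _ => abs_nonneg _)
  have htb : |t| ≤ b := Finset.abs_sum_le_sum_abs _ _
  have hX : |(∑ p, r p * a p) - t| ≤ c * η * b + c * v := by
    have e : (∑ p, r p * a p) - t = ∑ p ∈ B, (r p - 1) * a p + ∑ p ∈ Bᶜ, r p * a p := by
      rw [← Finset.sum_add_sum_compl B (fun p => r p * a p), ht]
      simp only [sub_mul, one_mul, Finset.sum_sub_distrib]
      ring
    rw [e]
    refine (abs_add_le _ _).trans (add_le_add ?_ ?_)
    · refine (Finset.abs_sum_le_sum_abs _ _).trans ?_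
      rw [hb, Finset.mul_sum]
      apply Finset.sum_le_sum
      intro p hp
      rw [abs_mul]
      exact mul_le_mul_of_nonneg_right (hr p hp) (abs_nonneg _)
    · refine (Finset.abs_sum_le_sum_abs _ _).trans ?_
      rw [hv, Finset.mul_sum]
      apply Finset.sum_le_sum
      intro p hp
      rw [abs_mul]
      exact mul_le_mul_of_nonneg_right (hr' p (Finset.mem_compl.mp hp)) (abs_nonneg _)
  have hY0 : ∑ p, ∑ q ∈ Finset.univ.erase p, (if p ∈ B ∧ q ∈ B then (1:ℝ) else 0) * a p * a q
      = t ^ 2 - ∑ p ∈ B, a p ^ 2 := by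
    have e1 : ∀ p, ∑ q ∈ Finset.univ.erase p, (if p ∈ B ∧ q ∈ B then (1:ℝ) else 0) * a p * a q
        = (if p ∈ B then a p * t - a p ^ 2 else 0) := by
      intro p
      have e2 := Finset.add_sum_erase Finset.univ
        (fun q => (if p ∈ B ∧ q ∈ B then (1:ℝ) else 0) * a p * a q) (Finset.mem_univ p)
      have e3 : ∑ q, (if p ∈ B ∧ q ∈ B then (1:ℝ) else 0) * a p * a q
          = if p ∈ B then a p * t else 0 := by
        split_ifs with hp
        · simp only [hp, true_and, ite_mul, one_mul, zero_mul, Finset.sum_ite_mem,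
            Finset.univ_inter]
          rw [ht, Finset.mul_sum]
        · simp [hp]
      rw [e3] at e2
      split_ifs with hp
      · simp only [hp, and_self, if_true, true_and] at e2 ⊢
        linarith
      · simp [hp]
    simp only [e1, Finset.sum_ite_mem, Finset.univ_inter, Finset.sum_sub_distrib]
    rw [← Finset.sum_mul, ← ht]; ring
  set u : ι → ℝ := fun p => if p ∈ B then |a p| else 0 with hu
  set z : ι → ℝ := fun p => if p ∈ B then 0 else |a p| with hz
  have hub : ∑ p, u p = b := by simp [hu, hb]
  have hzv : ∑ p, z p = v := by
    rw [← Finset.sum_add_sum_compl B, Finset.sum_eq_zero, zero_add, hv]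
    · apply Finset.sum_congr rfl
      intro p hp
      simp [hz, Finset.mem_compl.mp hp]
    · intro p hp; simp [hz, hp]
  have hu0 : ∀ p, 0 ≤ u p := by intro p; simp only [hu]; split_ifs <;> simp
  have hz0 : ∀ p, 0 ≤ z p := by intro p; simp only [hz]; split_ifs <;> simp
  have hY : |(∑ p, ∑ q ∈ Finset.univ.erase p, r2 p q * a p * a q)
      - (t ^ 2 - ∑ p ∈ B, a p ^ 2)| ≤ c * η * b ^ 2 + 2 * c * b * v + c * v ^ 2 := by
    rw [← hY0, ← Finset.sum_sub_distrib]
    have e : c * η * b ^ 2 + 2 * c * b * v + c * v ^ 2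
        = ∑ p, ∑ q, (c * η * (u p * u q) + c * (u p * z q) + c * (z p * u q)
            + c * (z p * z q)) := by
      simp only [Finset.sum_add_distrib, ← Finset.mul_sum, ← Finset.sum_mul, hub, hzv]
      ring
    rw [e]
    refine (Finset.abs_sum_le_sum_abs _ _).trans (Finset.sum_le_sum ?_)
    intro p _
    rw [← Finset.sum_sub_distrib]
    refine (Finset.abs_sum_le_sum_abs _ _).trans ?_
    refine le_trans ?_ (Finset.sum_le_sum_of_subset_of_nonneg (Finset.erase_subset p Finset.univ) ?_)
    · apply Finset.sum_le_sum
      intro q hq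
      have hpq : p ≠ q := (Finset.ne_of_mem_erase hq).symm
      rw [← sub_mul, ← sub_mul, abs_mul, abs_mul]
      have ha : 0 ≤ |a p| * |a q| := by positivity
      by_cases hp : p ∈ B <;> by_cases hqB : q ∈ B
      · have := mul_le_mul_of_nonneg_right (hr2 p hp q hqB hpq) ha
        simp only [hu, hz, hp, hqB, and_self, if_true]
        linarith
      · have := mul_le_mul_of_nonneg_right (hr2' p q hpq (Or.inr hqB)) ha
        simp only [hu, hz, hp, hqB, and_false, if_true, if_false, sub_zero]
        linarith
      · have := mul_le_mul_of_nonneg_right (hr2' p q hpq (Or.inl hp)) ha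
        simp only [hu, hz, hp, hqB, false_and, if_true, if_false, sub_zero]
        linarith
      · have := mul_le_mul_of_nonneg_right (hr2' p q hpq (Or.inl hp)) ha
        simp only [hu, hz, hp, hqB, false_and, if_false, sub_zero]
        linarith
    · intro q _ _
      have := hu0 p; have := hu0 q; have := hz0 p; have := hz0 q
      positivity
  set X := ∑ p, r p * a p
  set Y := ∑ p, ∑ q ∈ Finset.univ.erase p, r2 p q * a p * a q
  set s := ∑ p ∈ B, a p ^ 2
  have hY' := (abs_le.mp hY).2
  have h1 : t ^ 2 - 2 * b * (c * η * b + c * v) ≤ X ^ 2 := by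
    have e1 : |t| * |X - t| ≤ b * (c * η * b + c * v) :=
      mul_le_mul htb hX (abs_nonneg _) hb0
    rw [← abs_mul] at e1
    have := (abs_le.mp e1).1
    nlinarith [sq_nonneg (X - t)]
  have h2 : 0 ≤ b * (c * η * b + c * v) := by positivity
  have h3 := mul_le_mul_of_nonneg_left h1 (show (0:ℝ) ≤ 1 + c0 by linarith)
  nlinarith [mul_nonneg (sub_nonneg.mpr hc1) h2]

lemma form_index_one (B : Finset ι) (a : ι → ℝ) (i : ι) (hi : i ∈ B) (D : ℝ) (hD : 0 < D) :
    (1 + 1 / (D + (B.card - 1))) * a i ^ 2 ≤ ∑ p ∈ B, a p ^ 2 + 1 / D * (∑ p ∈ B, a p) ^ 2 := by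
  rw [← Finset.add_sum_erase B _ hi, ← Finset.add_sum_erase B (fun p => a p) hi]
  have hcs := sq_sum_le_card_mul_sum_sq (s := B.erase i) (f := a)
  have hcard : ((B.erase i).card : ℝ) = (B.card : ℝ) - 1 := by
    have h0 := Finset.card_erase_add_one hi
    rw [← h0]; push_cast; ring
  have he : 0 ≤ ((B.erase i).card : ℝ) := by positivity
  rw [← hcard]
  set e := ((B.erase i).card : ℝ)
  set b := ∑ p ∈ B.erase i, a p
  have hs0 : 0 ≤ ∑ p ∈ B.erase i, a p ^ 2 := Finset.sum_nonneg (fun _ _ => sq_nonneg _)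
  set s := ∑ p ∈ B.erase i, a p ^ 2
  set y := a i
  have hDe : 0 < D + e := by positivity
  suffices h : y ^ 2 / (D + e) ≤ s + (y + b) ^ 2 / D by
    have e1 : (1 + 1 / (D + e)) * y ^ 2 = y ^ 2 + y ^ 2 / (D + e) := by ring
    have e2 : 1 / D * (y + b) ^ 2 = (y + b) ^ 2 / D := by ring
    rw [e1, e2]; linarith
  rw [div_le_iff₀ hDe]
  obtain ⟨t, ht⟩ : ∃ t, t = y + b := ⟨_, rfl⟩
  have hy : y = t - b := by rw [ht]; ring
  rw [← ht, hy]
  have key : (t - b) ^ 2 * D ≤ (s * D + t ^ 2) * (D + e) := by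
    rcases eq_or_lt_of_le he with h0 | h0
    · rw [← h0] at hcs ⊢
      have : b = 0 := by nlinarith [sq_nonneg b]
      rw [this]
      nlinarith [mul_nonneg hs0 (mul_pos hD hD).le]
    · have h1 : 0 ≤ (D * b + e * t) ^ 2 := sq_nonneg _
      have h2 : 0 ≤ (e * s - b ^ 2) * (D * (D + e)) :=
        mul_nonneg (by linarith) (mul_pos hD hDe).le
      refine le_of_mul_le_mul_left ?_ h0
      nlinarith
  have : (s + t ^ 2 / D) * (D + e) = (s * D + t ^ 2) * (D + e) / D := by
    clear_value s e b y
    field_simp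
  rw [this, le_div_iff₀ hD]
  exact key

lemma form_final (B : Finset ι) (a : ι → ℝ) (r : ι → ℝ) (r2 : ι → ι → ℝ) (c η M : ℝ)
    (k μ : ℕ) (hk : μ < k) (hμ : B.card = μ) (i : ι) (hi : i ∈ B)
    (hc : 0 ≤ c) (hη : 0 < η)
    (hr : ∀ p ∈ B, |r p - 1| ≤ c * η) (hr' : ∀ p, p ∉ B → |r p| ≤ c)
    (hr2 : ∀ p ∈ B, ∀ q ∈ B, p ≠ q → |r2 p q - 1| ≤ c * η)
    (hr2' : ∀ p q, p ≠ q → (p ∉ B ∨ q ∉ B) → |r2 p q| ≤ c)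
    (hηs : 6 * c * η * Fintype.card ι ≤ 1 / (4 * (k : ℝ)))
    (hM : (9 / η + 1) * c * Fintype.card ι ≤ M) :
    (1 + 1 / (4 * (k : ℝ))) * a i ^ 2
    ≤ (1 + 1 / ((k : ℝ) - μ + 1)) * (∑ p, r p * a p) ^ 2
      - ∑ p, ∑ q ∈ Finset.univ.erase p, r2 p q * a p * a q + M * ∑ p ∈ Bᶜ, a p ^ 2 := by
  have hk1 : (μ : ℝ) + 1 ≤ k := by exact_mod_cast hk
  have hD : (0 : ℝ) < (k : ℝ) - μ + 1 := by linarith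
  have hkpos : (1 : ℝ) ≤ k := by
    have : (0 : ℝ) ≤ μ := by positivity
    linarith
  have hc1 : 1 / ((k : ℝ) - μ + 1) ≤ 1 := by
    rw [div_le_one hD]; linarith
  have h1 := form_lower B a r r2 c η (1 / ((k : ℝ) - μ + 1)) hc hη.le (by positivity) hc1
    hr hr' hr2 hr2'
  have h2 := form_index_one B a i hi ((k : ℝ) - μ + 1) hD
  rw [hμ, show ((k : ℝ) - μ + 1 + (μ - 1)) = k by ring] at h2
  have hb := sq_sum_le_card_mul_sum_sq (s := B) (f := fun p => |a p|)
  have hv := sq_sum_le_card_mul_sum_sq (s := Bᶜ) (f := fun p => |a p|)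
  simp only [sq_abs] at hb hv
  have hcB : (B.card : ℝ) ≤ Fintype.card ι := by exact_mod_cast Finset.card_le_univ _
  have hcV : (Bᶜ.card : ℝ) ≤ Fintype.card ι := by exact_mod_cast Finset.card_le_univ _
  have hs0 : 0 ≤ ∑ p ∈ B, a p ^ 2 := Finset.sum_nonneg (fun _ _ => sq_nonneg _)
  have hz0 : 0 ≤ ∑ p ∈ Bᶜ, a p ^ 2 := Finset.sum_nonneg (fun _ _ => sq_nonneg _)
  have hb0 : 0 ≤ ∑ p ∈ B, |a p| := Finset.sum_nonneg (fun _ _ => abs_nonneg _)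
  have hv0 : 0 ≤ ∑ p ∈ Bᶜ, |a p| := Finset.sum_nonneg (fun _ _ => abs_nonneg _)
  have hb' := hb.trans (mul_le_mul_of_nonneg_right hcB hs0)
  have hv' := hv.trans (mul_le_mul_of_nonneg_right hcV hz0)
  set N : ℝ := (Fintype.card ι : ℝ)
  set s := ∑ p ∈ B, a p ^ 2
  set z := ∑ p ∈ Bᶜ, a p ^ 2
  set b := ∑ p ∈ B, |a p|
  set v := ∑ p ∈ Bᶜ, |a p|
  set t := ∑ p ∈ B, a p
  have hcross : 6 * c * b * v ≤ c * η * b ^ 2 + 9 * c * v ^ 2 / η := by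
    have : c * η * b ^ 2 + 9 * c * v ^ 2 / η - 6 * c * b * v = c * (η * b - 3 * v) ^ 2 / η := by
      field_simp; ring
    have h3 : 0 ≤ c * (η * b - 3 * v) ^ 2 / η := by positivity
    linarith
  have herr1 : 6 * c * η * b ^ 2 ≤ 1 / (4 * (k : ℝ)) * s := by
    have e1 : 6 * c * η * b ^ 2 ≤ 6 * c * η * (N * s) :=
      mul_le_mul_of_nonneg_left hb' (by positivity)
    have e2 := mul_le_mul_of_nonneg_right hηs hs0
    linarith
  have herr2 : 9 * c * v ^ 2 / η + c * v ^ 2 ≤ M * z := by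
    have e0 : 9 * c * v ^ 2 / η + c * v ^ 2 = (9 / η + 1) * c * v ^ 2 := by ring
    have e1 : (9 / η + 1) * c * v ^ 2 ≤ (9 / η + 1) * c * (N * z) :=
      mul_le_mul_of_nonneg_left hv' (by positivity)
    have e2 := mul_le_mul_of_nonneg_right hM hz0
    linarith
  have hτ : 0 ≤ 1 - 1 / (4 * (k : ℝ)) := by
    have : 1 / (4 * (k : ℝ)) ≤ 1 := by rw [div_le_one (by positivity)]; linarith
    linarith
  have h3 := mul_le_mul_of_nonneg_left h2 hτ
  have h4 : (1 + 1 / (4 * (k : ℝ))) * a i ^ 2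
      ≤ (1 - 1 / (4 * (k : ℝ))) * ((1 + 1 / (k : ℝ)) * a i ^ 2) := by
    rw [← mul_assoc]
    apply mul_le_mul_of_nonneg_right _ (sq_nonneg _)
    have : (1 - 1 / (4 * (k : ℝ))) * (1 + 1 / (k : ℝ)) - (1 + 1 / (4 * (k : ℝ)))
        = (2 * (k : ℝ) - 1) / (4 * (k : ℝ) ^ 2) := by
      field_simp; ring
    have h5 : 0 ≤ (2 * (k : ℝ) - 1) / (4 * (k : ℝ) ^ 2) :=
      div_nonneg (by linarith) (by positivity)
    linarith
  have h6 : 0 ≤ 1 / (4 * (k : ℝ)) * (1 / ((k : ℝ) - μ + 1) * t ^ 2) := by positivity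
  nlinarith [h1, h3, h4, h6, herr1, herr2, hcross]

end Perturb

section ClaimA

variable {ι : Type*} [DecidableEq ι]

lemma ratio_near_one {A G s e : ℝ} (hG : 0 < G) (he : e ≤ 1 / 2)
    (hA : |A - G| ≤ e * G) (hs : |s - G| ≤ e * G) : |A / s - 1| ≤ 4 * e := by
  have h1 := abs_le.mp hs
  have h2 := abs_le.mp hA
  have hs0 : G / 2 ≤ s := by nlinarith
  have hs1 : 0 < s := by linarith
  have e0 : 0 ≤ e := by
    have := (abs_nonneg _).trans hs
    exact nonneg_of_mul_nonneg_left this hG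
  have : A / s - 1 = (A - s) / s := by field_simp
  rw [this, abs_div, abs_of_pos hs1, div_le_iff₀ hs1, abs_le]
  have h3 : e * (G / 2) ≤ e * s := mul_le_mul_of_nonneg_left hs0 e0
  constructor <;> nlinarith

lemma ratio_bdd {A G s e c : ℝ} (hG : 0 < G) (he : e ≤ 1 / 2)
    (hA : |A| ≤ c * G) (hs : |s - G| ≤ e * G) : |A / s| ≤ 4 * c := by
  have h1 := abs_le.mp hs
  have hs0 : G / 2 ≤ s := by nlinarith
  have hs1 : 0 < s := by linarith
  have c0 : 0 ≤ c := by
    have := (abs_nonneg _).trans hA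
    exact nonneg_of_mul_nonneg_left this hG
  rw [abs_div, abs_of_pos hs1, div_le_iff₀ hs1]
  have h3 : c * (G / 2) ≤ c * s := mul_le_mul_of_nonneg_left hs0 c0
  nlinarith

variable [Fintype ι]

lemma claim_sigma_mu (B : Finset ι) (x ξ : ι → ℝ) (k μ : ℕ) (hμ1 : 1 ≤ μ) (hk : μ < k)
    (hB : B.card = μ) (i : ι) (hi : i ∈ B) (δ η M c L : ℝ) (hL : 0 < L)
    (hδ : 0 < δ) (hδ1 : δ ≤ 1) (hη : 0 < η) (hη1 : η ≤ 1)
    (hc : c = 2 ^ (Fintype.card ι) / δ ^ μ)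
    (hBx : ∀ p ∈ B, δ * L ≤ x p ∧ x p ≤ L) (hV : ∀ v, v ∉ B → |x v| ≤ η * L)
    (hcη : c * η ≤ 1 / 2)
    (hηs : 6 * (4 * c) * η * Fintype.card ι ≤ 1 / (4 * (k : ℝ)))
    (hM : (9 / η + 1) * (4 * c) * Fintype.card ι ≤ M) (hxi : x i = L) :
    (1 + 1 / (4 * (k : ℝ))) * (ξ i ^ 2 / L ^ 2)
      ≤ (1 + 1 / ((k : ℝ) - μ + 1))
          * (EE1 Finset.univ (μ : ℤ) x ξ / EE Finset.univ (μ : ℤ) x) ^ 2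
        - EE2 Finset.univ (μ : ℤ) x ξ / EE Finset.univ (μ : ℤ) x
        + M * ∑ p ∈ Bᶜ, (ξ p ^ 2 / L ^ 2) := by
  set N := Fintype.card ι with hN
  set s := EE Finset.univ (μ : ℤ) x with hs
  set G := ∏ p ∈ B, x p with hG
  have hδL : 0 < δ * L := by positivity
  have hpos : ∀ p ∈ B, 0 < x p := fun p hp => hδL.trans_le (hBx p hp).1
  have hGpos : 0 < G := Finset.prod_pos hpos
  have hGlow : (δ * L) ^ μ ≤ G := by
    rw [← hB, ← Finset.prod_const]
    exact Finset.prod_le_prod (fun _ _ => hδL.le) (fun p hp => (hBx p hp).1)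
  have hc0 : 0 ≤ c := by rw [hc]; positivity
  have hcG : 2 ^ N * L ^ μ ≤ c * G := by
    have : 2 ^ N * L ^ μ = c * (δ * L) ^ μ := by
      rw [hc, mul_pow]; field_simp
    rw [this]
    exact mul_le_mul_of_nonneg_left hGlow hc0
  have hcGη : 2 ^ N * η * L ^ μ ≤ c * η * G := by
    have := mul_le_mul_of_nonneg_left hcG hη.le
    linarith
  have habs : ∀ p, |x p| ≤ L := by
    intro p
    by_cases hp : p ∈ B
    · rw [abs_of_pos (hpos p hp)]; exact (hBx p hp).2
    · exact (hV p hp).trans (by nlinarith)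
  have hcardN : ∀ T : Finset ι, T.card ≤ N := fun T => Finset.card_le_univ T
  have hsG : |s - G| ≤ c * η * G := by
    have := EE_sub_prod_le Finset.univ B (Finset.subset_univ _) x L η hL.le hη.le
      (fun p _ => habs p) (fun p _ hp => hV p hp) N (hcardN _)
    rw [hB] at this
    exact this.trans hcGη
  set w : ι → ℝ := fun p => if p ∈ B then x p else L with hw
  have hwpos : ∀ p, 0 < w p := by
    intro p; simp only [hw]; split_ifs with h
    · exact hpos p h
    · exact hL
  have hwL : ∀ p, w p ≤ L := by
    intro p; simp only [hw]; split_ifs with h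
    · exact (hBx p h).2
    · exact le_rfl
  set a : ι → ℝ := fun p => ξ p / w p with ha
  have hξ : ∀ p, ξ p = w p * a p := by
    intro p; simp only [ha]; have := (hwpos p).ne'; field_simp
  have hμm : ((μ : ℤ) - 1) = ((μ - 1 : ℕ) : ℤ) := by omega
  have hLμ : L * L ^ (μ - 1) = L ^ μ := by
    rw [← pow_succ']; congr 1; omega
  have hr : ∀ p ∈ B, |w p * EE (Finset.univ.erase p) ((μ : ℤ) - 1) x / s - 1| ≤ 4 * c * η := by
    intro p hp
    rw [mul_assoc]
    refine ratio_near_one hGpos hcη ?_ hsG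
    have hcard : (B.erase p).card = μ - 1 := by rw [Finset.card_erase_of_mem hp, hB]
    have h1 := EE_sub_prod_le (Finset.univ.erase p) (B.erase p)
      (Finset.erase_subset_erase _ (Finset.subset_univ _)) x L η hL.le hη.le
      (fun p _ => habs p) (fun q hq hqB => hV q (fun h => hqB
        (Finset.mem_erase.mpr ⟨Finset.ne_of_mem_erase hq, h⟩))) N (hcardN _)
    rw [hcard, ← hμm] at h1
    have h2 : w p * EE (Finset.univ.erase p) ((μ : ℤ) - 1) x - G
        = x p * (EE (Finset.univ.erase p) ((μ : ℤ) - 1) x - ∏ q ∈ B.erase p, x q) := by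
      rw [mul_sub, Finset.mul_prod_erase B x hp]; simp [hw, hp, hG]
    rw [h2, abs_mul]
    calc |x p| * |EE (Finset.univ.erase p) ((μ : ℤ) - 1) x - ∏ q ∈ B.erase p, x q|
        ≤ L * (2 ^ N * η * L ^ (μ - 1)) := mul_le_mul (habs p) h1 (abs_nonneg _) hL.le
      _ = 2 ^ N * η * (L * L ^ (μ - 1)) := by ring
      _ = 2 ^ N * η * L ^ μ := by rw [hLμ]
      _ ≤ c * η * G := hcGη
  have hr' : ∀ p, p ∉ B → |w p * EE (Finset.univ.erase p) ((μ : ℤ) - 1) x / s| ≤ 4 * c := by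
    intro p _
    refine ratio_bdd hGpos hcη ?_ hsG
    rw [abs_mul, abs_of_pos (hwpos p), hμm]
    have h1 := EE_abs_le (Finset.univ.erase p) x L hL.le (fun p _ => habs p) (μ - 1) N (hcardN _)
    calc w p * |EE (Finset.univ.erase p) ((μ - 1 : ℕ) : ℤ) x|
        ≤ L * (2 ^ N * L ^ (μ - 1)) := mul_le_mul (hwL p) h1 (abs_nonneg _) hL.le
      _ = 2 ^ N * (L * L ^ (μ - 1)) := by ring
      _ = 2 ^ N * L ^ μ := by rw [hLμ]
      _ ≤ c * G := hcG
  have hr2 : ∀ p ∈ B, ∀ q ∈ B, p ≠ q →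
      |w p * w q * EE ((Finset.univ.erase p).erase q) ((μ : ℤ) - 1 - 1) x / s - 1|
        ≤ 4 * c * η := by
    intro p hp q hq hpq
    rw [mul_assoc 4]
    refine ratio_near_one hGpos hcη ?_ hsG
    have hq' : q ∈ B.erase p := Finset.mem_erase.mpr ⟨hpq.symm, hq⟩
    have hcard : ((B.erase p).erase q).card = μ - 2 := by
      rw [Finset.card_erase_of_mem hq', Finset.card_erase_of_mem hp, hB]; omega
    have hμ2 : 2 ≤ μ := by
      rw [← hB]; exact Finset.one_lt_card.mpr ⟨p, hp, q, hq, hpq⟩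
    have hμm2 : ((μ : ℤ) - 1 - 1) = ((μ - 2 : ℕ) : ℤ) := by omega
    have hLμ2 : L * L * L ^ (μ - 2) = L ^ μ := by
      rw [mul_assoc, ← pow_succ', ← pow_succ']; congr 1; omega
    have h1 := EE_sub_prod_le ((Finset.univ.erase p).erase q) ((B.erase p).erase q)
      (Finset.erase_subset_erase _ (Finset.erase_subset_erase _ (Finset.subset_univ _)))
      x L η hL.le hη.le
      (fun p _ => habs p) (fun u hu huB => hV u (fun h => huB (by
        simp only [Finset.mem_erase] at hu ⊢; tauto))) N (hcardN _)
    rw [hcard, ← hμm2] at h1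
    have h2 : w p * w q * EE ((Finset.univ.erase p).erase q) ((μ : ℤ) - 1 - 1) x - G
        = x p * x q * (EE ((Finset.univ.erase p).erase q) ((μ : ℤ) - 1 - 1) x
          - ∏ u ∈ (B.erase p).erase q, x u) := by
      rw [mul_sub, mul_assoc (x p) (x q) (∏ u ∈ (B.erase p).erase q, x u),
        Finset.mul_prod_erase (B.erase p) x hq', Finset.mul_prod_erase B x hp]
      simp [hw, hp, hq, hG]
    rw [h2, abs_mul, abs_mul]
    calc |x p| * |x q| * |EE ((Finset.univ.erase p).erase q) ((μ : ℤ) - 1 - 1) x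
          - ∏ u ∈ (B.erase p).erase q, x u|
        ≤ L * L * (2 ^ N * η * L ^ (μ - 2)) :=
          mul_le_mul (mul_le_mul (habs p) (habs q) (abs_nonneg _) hL.le) h1 (abs_nonneg _)
            (by positivity)
      _ = 2 ^ N * η * (L * L * L ^ (μ - 2)) := by ring
      _ = 2 ^ N * η * L ^ μ := by rw [hLμ2]
      _ ≤ c * η * G := hcGη
  have hr2' : ∀ p q, p ≠ q → (p ∉ B ∨ q ∉ B) →
      |w p * w q * EE ((Finset.univ.erase p).erase q) ((μ : ℤ) - 1 - 1) x / s| ≤ 4 * c := by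
    intro p q _ _
    refine ratio_bdd hGpos hcη ?_ hsG
    rcases Nat.lt_or_ge μ 2 with h2 | h2
    · rw [EE_neg _ (by omega), mul_zero, abs_zero]; positivity
    have hμm2 : ((μ : ℤ) - 1 - 1) = ((μ - 2 : ℕ) : ℤ) := by omega
    have hLμ2 : L * L * L ^ (μ - 2) = L ^ μ := by
      rw [mul_assoc, ← pow_succ', ← pow_succ']; congr 1; omega
    rw [abs_mul, abs_mul, abs_of_pos (hwpos p), abs_of_pos (hwpos q), hμm2]
    have h1 := EE_abs_le ((Finset.univ.erase p).erase q) x L hL.le (fun p _ => habs p)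
      (μ - 2) N (hcardN _)
    calc w p * w q * |EE ((Finset.univ.erase p).erase q) ((μ - 2 : ℕ) : ℤ) x|
        ≤ L * L * (2 ^ N * L ^ (μ - 2)) :=
          mul_le_mul (mul_le_mul (hwL p) (hwL q) (hwpos q).le hL.le) h1 (abs_nonneg _)
            (by positivity)
      _ = 2 ^ N * (L * L * L ^ (μ - 2)) := by ring
      _ = 2 ^ N * L ^ μ := by rw [hLμ2]
      _ ≤ c * G := hcG
  have hfin := form_final B a
    (fun p => w p * EE (Finset.univ.erase p) ((μ : ℤ) - 1) x / s)
    (fun p q => w p * w q * EE ((Finset.univ.erase p).erase q) ((μ : ℤ) - 1 - 1) x / s)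
    (4 * c) η M k μ hk hB i hi (by positivity) hη hr hr' hr2 hr2' hηs hM
  have e1 : ∑ p, (w p * EE (Finset.univ.erase p) ((μ : ℤ) - 1) x / s) * a p
      = EE1 Finset.univ (μ : ℤ) x ξ / s := by
    rw [EE1, Finset.sum_div]
    apply Finset.sum_congr rfl
    intro p _
    rw [hξ p]; ring
  have e2 : ∑ p, ∑ q ∈ Finset.univ.erase p,
      (w p * w q * EE ((Finset.univ.erase p).erase q) ((μ : ℤ) - 1 - 1) x / s) * a p * a q
      = EE2 Finset.univ (μ : ℤ) x ξ / s := by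
    rw [EE2, Finset.sum_div]
    apply Finset.sum_congr rfl
    intro p _
    rw [EE1, Finset.mul_sum, Finset.sum_div]
    apply Finset.sum_congr rfl
    intro q _
    rw [hξ p, hξ q]; ring
  have e3 : ∑ p ∈ Bᶜ, a p ^ 2 = ∑ p ∈ Bᶜ, (ξ p ^ 2 / L ^ 2) := by
    apply Finset.sum_congr rfl
    intro p hp
    have := Finset.mem_compl.mp hp
    simp [ha, hw, this, div_pow]
  have e4 : a i ^ 2 = ξ i ^ 2 / L ^ 2 := by
    simp [ha, hw, hi, hxi, div_pow]
  rw [e1, e2, e3, e4] at hfin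
  exact hfin

lemma claim_A (B : Finset ι) (x ξ : ι → ℝ) (k μ : ℕ) (hμ1 : 1 ≤ μ) (hk : μ < k)
    (hB : B.card = μ) (i : ι) (hi : i ∈ B) (δ η δ' c L κ : ℝ) (hL : 0 < L)
    (hδ : 0 < δ) (hδ1 : δ ≤ 1) (hη : 0 < η) (hη1 : η ≤ 1) (hδ' : 0 < δ')
    (hc : c = 2 ^ (Fintype.card ι) / δ ^ μ)
    (hBx : ∀ p ∈ B, δ * L ≤ x p ∧ x p ≤ L) (hV : ∀ v, v ∉ B → |x v| ≤ η * L)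
    (hV' : ∀ v, v ∉ B → x v ≤ δ' * L)
    (hcη : c * η ≤ 1 / 2)
    (hηs : 6 * (4 * c) * η * Fintype.card ι ≤ 1 / (4 * (k : ℝ)))
    (hM : (9 / η + 1) * (4 * c) * Fintype.card ι ≤ 1 / (((Fintype.card ι : ℝ) + 1) * δ'))
    (hxi : x i = L) (hκ : 0 < κ) (hκL : κ ≤ 2 * L) (hcone : Cone Finset.univ (k : ℤ) x) :
    (1 + 1 / (4 * (k : ℝ))) * (ξ i ^ 2 / L ^ 2) * EE Finset.univ (k : ℤ) x
      ≤ 2 * (EE1 Finset.univ (k : ℤ) x ξ) ^ 2 / EE Finset.univ (k : ℤ) x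
        - EE2 Finset.univ (k : ℤ) x ξ
        + 2 / κ * ∑ p ∈ Bᶜ, EE (Finset.univ.erase p) ((k : ℤ) - 1) x * ξ p ^ 2 := by
  have h1 := claim_sigma_mu B x ξ k μ hμ1 hk hB i hi δ η _ c L hL hδ hδ1 hη hη1 hc hBx hV
    hcη hηs hM hxi
  have h2 := log_lower x ξ μ k hk Finset.univ hcone
  have hS : 0 < EE Finset.univ (k : ℤ) x := hcone _ (by omega) le_rfl
  set S := EE Finset.univ (k : ℤ) x with hSdef
  have h3 : (1 / (((Fintype.card ι : ℝ) + 1) * δ') * ∑ p ∈ Bᶜ, (ξ p ^ 2 / L ^ 2)) * S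
      ≤ 2 / κ * ∑ p ∈ Bᶜ, EE (Finset.univ.erase p) ((k : ℤ) - 1) x * ξ p ^ 2 := by
    rw [Finset.mul_sum, Finset.sum_mul, Finset.mul_sum]
    apply Finset.sum_le_sum
    intro p hp
    have hpB := Finset.mem_compl.mp hp
    have hq := quot_bound' B (k : ℤ) (by omega) x (δ' * L) (by positivity) Finset.univ
      (fun v _ hv => hV' v hv) hcone (Finset.mem_univ p) hpB
    rw [Finset.card_univ, ← hSdef] at hq
    have hsp : 0 < EE (Finset.univ.erase p) ((k : ℤ) - 1) x :=
      hcone.erase (Finset.mem_univ p) _ (by omega) le_rfl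
    set sp := EE (Finset.univ.erase p) ((k : ℤ) - 1) x
    set Q : ℝ := (Fintype.card ι : ℝ) + 1
    have hQ : 0 < Q := by positivity
    have e1 : 1 / (Q * δ') * (ξ p ^ 2 / L ^ 2) * S
        ≤ 1 / (Q * δ') * (ξ p ^ 2 / L ^ 2) * (Q * (δ' * L) * sp) :=
      mul_le_mul_of_nonneg_left hq (by positivity)
    have e2 : 1 / (Q * δ') * (ξ p ^ 2 / L ^ 2) * (Q * (δ' * L) * sp)
        = 1 / L * (sp * ξ p ^ 2) := by field_simp
    have e3 : 1 / L ≤ 2 / κ := by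
      rw [div_le_div_iff₀ hL hκ]; linarith
    rw [e2] at e1
    exact e1.trans (mul_le_mul_of_nonneg_right e3 (by positivity))
  have h4 := mul_le_mul_of_nonneg_right (h1.trans (add_le_add_left h2 _)) hS.le
  have h5 : (2 * (EE1 Finset.univ (k : ℤ) x ξ / S) ^ 2 - EE2 Finset.univ (k : ℤ) x ξ / S) * S
      = 2 * (EE1 Finset.univ (k : ℤ) x ξ) ^ 2 / S - EE2 Finset.univ (k : ℤ) x ξ := by
    field_simp
  rw [add_mul _ _ S, h5] at h4
  linarith

end ClaimA

section Algebra

lemma range_split (q : ℕ) (f : ℕ → ℝ) :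
    ∑ l ∈ Finset.range (q + 3), f l
      = f 0 + ∑ l ∈ Finset.Icc 1 q, f l + f (q + 1) + f (q + 2) := by
  rw [Finset.sum_range_succ, Finset.sum_range_succ, Finset.range_eq_Ico,
    Finset.sum_eq_sum_Ico_succ_bot (by omega)]
  rfl

lemma quad_ineq (M ε R Z a b Y u w : ℝ) (hM : 4 ≤ M) (hε : 0 < ε) (hε1 : ε ≤ 1 / 8)
    (hR : 0 ≤ R) (hZ : 0 ≤ Z) (hu : 0 ≤ u) (hw : 0 ≤ w) (hab : a ^ 2 = u * w)
    (hY : Y ^ 2 ≤ R * Z) (hb : b = u + R) :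
    (M - 1) * b * w + (M + 3) * b * Z - (M + ε) * (a + Y) ^ 2 ≥ -(1 + ε) * a ^ 2 := by
  subst hb
  have hc : (M + ε) ^ 2 ≤ (M - 1) * (M + 3) := by nlinarith
  have h1 : (M + ε) * Y ^ 2 ≤ (M + 3) * (R * Z) := by
    have : (M + ε) * Y ^ 2 ≤ (M + ε) * (R * Z) := mul_le_mul_of_nonneg_left hY (by linarith)
    have h2 : 0 ≤ R * Z := mul_nonneg hR hZ
    nlinarith
  have h2 : 2 * (M + ε) * (a * Y) ≤ (M - 1) * R * w + (M + 3) * u * Z := by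
    have h3 : (a * Y) ^ 2 ≤ (R * w) * (u * Z) := by
      rw [mul_pow, hab]
      calc u * w * Y ^ 2 ≤ u * w * (R * Z) := mul_le_mul_of_nonneg_left hY (by positivity)
        _ = _ := by ring
    have hp : 0 ≤ R * w := by positivity
    have hq : 0 ≤ u * Z := by positivity
    apply le_of_sq_le_sq _ (by nlinarith)
    have h4 : (M + ε) ^ 2 * (a * Y) ^ 2 ≤ (M - 1) * (M + 3) * ((R * w) * (u * Z)) :=
      mul_le_mul hc h3 (by positivity) (by nlinarith)
    nlinarith [sq_nonneg ((M - 1) * (R * w) - (M + 3) * (u * Z))]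
  nlinarith

variable {ι : Type*} [Fintype ι] [DecidableEq ι]

set_option maxHeartbeats 1000000 in
lemma algebra_final (i : ι) (κ s t ξ : ι → ℝ) (S X ε : ℝ) (m : ℕ) (hm : 4 ≤ m)
    (hε : 0 < ε) (hε1 : ε ≤ 1 / 8) (hκi : 0 < κ i) (hκ : ∀ j, 0 ≤ κ j)
    (hκle : ∀ j, κ j ≤ κ i) (hs : ∀ j, 0 ≤ s j) (hs1 : ∀ j, s i ≤ s j)
    (ht : ∀ j, j ≠ i → 0 ≤ t j) (hS : 0 ≤ S)
    (hX : (1 + ε) * S * (ξ i ^ 2 / κ i ^ 2)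
      ≤ X + 2 / κ i * ∑ j ∈ Finset.univ.erase i, s j * ξ j ^ 2) :
    ((∑ j, κ j ^ m) ^ 2 / (m : ℝ)) *
        ((m : ℝ) / (∑ j, κ j ^ m) * κ i ^ (m - 1) * X
          + (2 * (m : ℝ) / ∑ j, κ j ^ m) *
            ∑ j ∈ Finset.univ.erase i, κ j ^ (m - 1) * t j * (ξ j) ^ 2
          + ((m : ℝ) * ((m : ℝ) - 1) / ∑ j, κ j ^ m) * s i * ∑ j, κ j ^ (m - 2) * (ξ j) ^ 2
          + (2 * (m : ℝ) / ∑ j, κ j ^ m) * ∑ j ∈ Finset.univ.erase i, s j *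
            (∑ l ∈ Finset.range (m - 1), κ i ^ (m - 2 - l) * κ j ^ l) * (ξ j) ^ 2
          - (1 + ε / (m : ℝ)) * (((m : ℝ) ^ 2 / (∑ j, κ j ^ m) ^ 2) * s i *
            (∑ j, κ j ^ (m - 1) * ξ j) ^ 2))
      ≥ (1 + ε) * (S - κ i * s i) * κ i ^ (2 * m - 3) * ξ i ^ 2
        + 2 * (∑ j, κ j ^ m) * ∑ j ∈ Finset.univ.erase i, s j *
            (∑ l ∈ Finset.Icc 1 (m - 4), κ j ^ l * κ i ^ (m - 2 - l)) * (ξ j) ^ 2 := by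
  obtain ⟨q, rfl⟩ : ∃ q, m = q + 4 := ⟨m - 4, by omega⟩
  have e1 : q + 4 - 1 = q + 3 := by omega
  have e2 : q + 4 - 2 = q + 2 := by omega
  have e3 : 2 * (q + 4) - 3 = 2 * q + 5 := by omega
  have e4 : q + 4 - 4 = q := by omega
  rw [e1, e2, e3, e4]
  have hP : ∑ j, κ j ^ (q + 4) = κ i ^ (q + 4) + ∑ j ∈ Finset.univ.erase i, κ j ^ (q + 4) :=
    (Finset.add_sum_erase _ _ (Finset.mem_univ i)).symm
  have hC : ∑ j, κ j ^ (q + 2) * ξ j ^ 2 = κ i ^ (q + 2) * ξ i ^ 2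
      + ∑ j ∈ Finset.univ.erase i, κ j ^ (q + 2) * ξ j ^ 2 :=
    (Finset.add_sum_erase _ _ (Finset.mem_univ i)).symm
  have hE : ∑ j, κ j ^ (q + 3) * ξ j = κ i ^ (q + 3) * ξ i
      + ∑ j ∈ Finset.univ.erase i, κ j ^ (q + 3) * ξ j :=
    (Finset.add_sum_erase _ _ (Finset.mem_univ i)).symm
  have hPpos : 0 < ∑ j, κ j ^ (q + 4) := by
    rw [hP]
    have : 0 ≤ ∑ j ∈ Finset.univ.erase i, κ j ^ (q + 4) :=
      Finset.sum_nonneg fun j _ => pow_nonneg (hκ j) _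
    positivity
  have hB : 0 ≤ ∑ j ∈ Finset.univ.erase i, κ j ^ (q + 3) * t j * (ξ j) ^ 2 := by
    apply Finset.sum_nonneg
    intro j hj
    have h1 := ht j (Finset.ne_of_mem_erase hj)
    have h2 := hκ j
    positivity
  have hD : ∑ j ∈ Finset.univ.erase i, s j *
            (∑ l ∈ Finset.Icc 1 q, κ j ^ l * κ i ^ (q + 2 - l)) * (ξ j) ^ 2
        + κ i ^ (q + 2) * ∑ j ∈ Finset.univ.erase i, s j * ξ j ^ 2
        + 2 * s i * ∑ j ∈ Finset.univ.erase i, κ j ^ (q + 2) * ξ j ^ 2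
      ≤ ∑ j ∈ Finset.univ.erase i, s j *
            (∑ l ∈ Finset.range (q + 3), κ i ^ (q + 2 - l) * κ j ^ l) * (ξ j) ^ 2 := by
    rw [Finset.mul_sum, Finset.mul_sum, ← Finset.sum_add_distrib, ← Finset.sum_add_distrib]
    apply Finset.sum_le_sum
    intro j hj
    rw [range_split]
    have e5 : q + 2 - (q + 1) = 1 := by omega
    have e6 : q + 2 - (q + 2) = 0 := by omega
    rw [e5, e6, pow_zero, pow_zero, pow_one, Nat.sub_zero]
    simp_rw [mul_comm (κ j ^ _) (κ i ^ _)]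
    have h1 : s i * κ j ^ (q + 2) ≤ s j * κ j ^ (q + 2) :=
      mul_le_mul_of_nonneg_right (hs1 j) (pow_nonneg (hκ j) _)
    have h2 : κ j ^ (q + 2) ≤ κ i * κ j ^ (q + 1) := by
      rw [pow_succ' (κ j) (q + 1)]
      exact mul_le_mul_of_nonneg_right (hκle j) (pow_nonneg (hκ j) _)
    have h3 : s j * κ j ^ (q + 2) ≤ s j * (κ i * κ j ^ (q + 1)) :=
      mul_le_mul_of_nonneg_left h2 (hs j)
    have h4 : 2 * (s i * κ j ^ (q + 2)) * ξ j ^ 2 ≤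
        (s j * (κ i * κ j ^ (q + 1)) + s j * κ j ^ (q + 2)) * ξ j ^ 2 :=
      mul_le_mul_of_nonneg_right (by linarith) (sq_nonneg _)
    nlinarith
  have hR : 0 ≤ ∑ j ∈ Finset.univ.erase i, κ j ^ (q + 4) :=
    Finset.sum_nonneg fun j _ => pow_nonneg (hκ j) _
  have hZ : 0 ≤ ∑ j ∈ Finset.univ.erase i, κ j ^ (q + 2) * ξ j ^ 2 :=
    Finset.sum_nonneg fun j _ => mul_nonneg (pow_nonneg (hκ j) _) (sq_nonneg _)
  have hCS : (∑ j ∈ Finset.univ.erase i, κ j ^ (q + 3) * ξ j) ^ 2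
      ≤ (∑ j ∈ Finset.univ.erase i, κ j ^ (q + 4))
        * ∑ j ∈ Finset.univ.erase i, κ j ^ (q + 2) * ξ j ^ 2 := by
    apply Finset.sum_sq_le_sum_mul_sum_of_sq_eq_mul
    · intro j _; exact pow_nonneg (hκ j) _
    · intro j _; exact mul_nonneg (pow_nonneg (hκ j) _) (sq_nonneg _)
    · intro j _; ring
  set P := ∑ j, κ j ^ (q + 4) with hPdef
  set R := ∑ j ∈ Finset.univ.erase i, κ j ^ (q + 4)
  set Z := ∑ j ∈ Finset.univ.erase i, κ j ^ (q + 2) * ξ j ^ 2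
  set Y := ∑ j ∈ Finset.univ.erase i, κ j ^ (q + 3) * ξ j
  set Bs := ∑ j ∈ Finset.univ.erase i, κ j ^ (q + 3) * t j * (ξ j) ^ 2
  set Ds := ∑ j ∈ Finset.univ.erase i, s j *
            (∑ l ∈ Finset.range (q + 3), κ i ^ (q + 2 - l) * κ j ^ l) * (ξ j) ^ 2
  set D0 := ∑ j ∈ Finset.univ.erase i, s j *
            (∑ l ∈ Finset.Icc 1 q, κ j ^ l * κ i ^ (q + 2 - l)) * (ξ j) ^ 2
  set Q := ∑ j ∈ Finset.univ.erase i, s j * ξ j ^ 2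
  rw [hC, hE]
  have hMpos : (4 : ℝ) ≤ ((q + 4 : ℕ) : ℝ) := by push_cast; linarith [Nat.cast_nonneg (α := ℝ) q]
  set M : ℝ := ((q + 4 : ℕ) : ℝ) with hMdef
  have hquad := quad_ineq M ε R Z (κ i ^ (q + 3) * ξ i) P Y (κ i ^ (q + 4))
    (κ i ^ (q + 2) * ξ i ^ 2) hMpos hε hε1 hR hZ (by positivity) (by positivity) (by ring)
    hCS hP
  have hquad2 := mul_le_mul_of_nonneg_left hquad (hs i)
  have hXm : (1 + ε) * S * κ i ^ (2 * q + 5) * ξ i ^ 2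
      ≤ P * κ i ^ (q + 3) * X + 2 * P * (κ i ^ (q + 2) * Q) := by
    have h1 := mul_le_mul_of_nonneg_left hX (show 0 ≤ P * κ i ^ (q + 3) by positivity)
    have h2 : P * κ i ^ (q + 3) * (X + 2 / κ i * Q)
        = P * κ i ^ (q + 3) * X + 2 * P * (κ i ^ (q + 2) * Q) := by
      field_simp
      ring
    rw [h2] at h1
    refine le_trans ?_ h1
    have h3 : (1 + ε) * S * κ i ^ (2 * q + 5) * ξ i ^ 2
        = κ i ^ (q + 4) * (κ i ^ (q + 3) * ((1 + ε) * S * (ξ i ^ 2 / κ i ^ 2))) := by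
      field_simp
      ring
    rw [h3, mul_assoc P]
    apply mul_le_mul_of_nonneg_right _ (by positivity)
    rw [hP]; linarith
  have hM0 : M ≠ 0 := by linarith
  have hP0 : P ≠ 0 := hPpos.ne'
  have hL : P ^ 2 / M * (M / P * κ i ^ (q + 3) * X + 2 * M / P * Bs
        + M * (M - 1) / P * s i * (κ i ^ (q + 2) * ξ i ^ 2 + Z) + 2 * M / P * Ds
        - (1 + ε / M) * (M ^ 2 / P ^ 2 * s i * (κ i ^ (q + 3) * ξ i + Y) ^ 2))
      = P * κ i ^ (q + 3) * X + 2 * P * Bs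
        + (M - 1) * P * s i * (κ i ^ (q + 2) * ξ i ^ 2 + Z) + 2 * P * Ds
        - (M + ε) * s i * (κ i ^ (q + 3) * ξ i + Y) ^ 2 := by
    field_simp
  rw [hL]
  have hBm : 0 ≤ 2 * P * Bs := by positivity
  have hDm := mul_le_mul_of_nonneg_left hD (show 0 ≤ 2 * P by positivity)
  have hfin : (1 + ε) * (S - κ i * s i) * κ i ^ (2 * q + 5) * ξ i ^ 2
      = (1 + ε) * S * κ i ^ (2 * q + 5) * ξ i ^ 2
        + s i * (-(1 + ε) * (κ i ^ (q + 3) * ξ i) ^ 2) := by ring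
  rw [hfin]
  nlinarith

end Algebra

section Translate

variable {n : ℕ}

/-- The vector `λ` with the extra entry `α`. -/
def extv (α : ℝ) (lam : Fin n → ℝ) : Option (Fin n) → ℝ := fun o => o.elim α lam

lemma EE_map_some (α : ℝ) (lam : Fin n → ℝ) (T : Finset (Fin n)) (j : ℤ) :
    EE (T.map Function.Embedding.some) j (extv α lam) = sigmaOn T j lam := by
  unfold EE sigmaOn
  split_ifs with h
  · rw [Finset.powersetCard_map, Finset.sum_map]
    apply Finset.sum_congr rfl
    intro s _
    simp [extv, Finset.mapEmbedding]
  · rfl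

lemma EE_insertNone (α : ℝ) (lam : Fin n → ℝ) (T : Finset (Fin n)) (j : ℤ) :
    EE (insert none (T.map Function.Embedding.some)) j (extv α lam)
      = sigmaOn T j lam + α * sigmaOn T (j - 1) lam := by
  rw [EE_insert (by simp), EE_map_some, EE_map_some]
  rfl

lemma univ_option_eq : (Finset.univ : Finset (Option (Fin n)))
    = insert none ((Finset.univ : Finset (Fin n)).map Function.Embedding.some) := by
  ext o; cases o <;> simp

lemma insert_erase_some (T : Finset (Fin n)) (p : Fin n) :
    (insert none (T.map Function.Embedding.some)).erase (some p)
      = insert none ((T.erase p).map Function.Embedding.some) := by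
  ext o; cases o <;> simp

lemma Sfun_eq (α : ℝ) (lam : Fin n → ℝ) (k : ℤ) :
    Sfun α k lam = EE Finset.univ k (extv α lam) := by
  rw [univ_option_eq, EE_insertNone]; rfl

lemma SD_eq (α : ℝ) (lam : Fin n → ℝ) (k : ℤ) (p : Fin n) :
    SD α k lam p = EE (Finset.univ.erase (some p)) (k - 1) (extv α lam) := by
  rw [univ_option_eq, insert_erase_some, EE_insertNone]
  have : k - 1 - 1 = k - 2 := by ring
  rw [this]; rfl

lemma SDD_eq (α : ℝ) (lam : Fin n → ℝ) (k : ℤ) (p q : Fin n) :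
    SDD α k lam p q
      = EE ((Finset.univ.erase (some p)).erase (some q)) (k - 2) (extv α lam) := by
  rw [univ_option_eq, insert_erase_some, insert_erase_some, EE_insertNone]
  have : k - 2 - 1 = k - 3 := by ring
  rw [this]; rfl

lemma EE1_eq (α : ℝ) (lam ξ : Fin n → ℝ) (k : ℤ) :
    EE1 Finset.univ k (extv α lam) (extv 0 ξ) = ∑ p, SD α k lam p * ξ p := by
  unfold EE1
  rw [Fintype.sum_option]
  simp only [SD_eq]
  simp [extv, mul_comm]

lemma EE2_eq (α : ℝ) (lam ξ : Fin n → ℝ) (k : ℤ) :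
    EE2 Finset.univ k (extv α lam) (extv 0 ξ)
      = ∑ p, ∑ q ∈ Finset.univ.erase p, SDD α k lam p q * ξ p * ξ q := by
  unfold EE2 EE1
  rw [Fintype.sum_option]
  have h0 : extv 0 ξ none = 0 := rfl
  rw [h0, zero_mul, zero_add]
  apply Finset.sum_congr rfl
  intro p _
  simp only [SDD_eq]
  have h1 : (Finset.univ : Finset (Option (Fin n))).erase (some p)
      = insert none ((Finset.univ.erase p).map Function.Embedding.some) := by
    rw [univ_option_eq, insert_erase_some]
  have h2 : k - 1 - 1 = k - 2 := by ring
  conv_lhs => rw [h1]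
  rw [Finset.sum_insert (by simp), h0, zero_mul, zero_add, Finset.sum_map, Finset.mul_sum, h2,
    ← h1]
  apply Finset.sum_congr rfl
  intro q _
  simp only [extv, Function.Embedding.some_apply, Option.elim]
  ring

lemma cone_of_GammaTilde {k : ℕ} (hk : 1 ≤ k) (α : ℝ) (hα : 0 < α) (lam : Fin n → ℝ)
    (h : lam ∈ GammaTilde n k α) : Cone Finset.univ (k : ℤ) (extv α lam) := by
  obtain ⟨h1, h2⟩ := h
  intro j hj0 hjk
  rw [← Sfun_eq]
  have hσ : ∀ l : ℤ, 0 ≤ l → l ≤ (k : ℤ) - 1 → 0 < esymmR l lam := by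
    intro l hl hl'
    lift l to ℕ using hl
    rcases Nat.eq_zero_or_pos l with rfl | hp
    · simp [esymmR, sigmaOn]
    · exact h1 l hp (by omega)
  rcases eq_or_lt_of_le hjk with rfl | hlt
  · exact h2
  · have ha := hσ j hj0 (by omega)
    unfold Sfun
    rcases eq_or_lt_of_le hj0 with rfl | hpos
    · have : esymmR (0 - 1) lam = 0 := by simp [esymmR, sigmaOn]
      rw [this]; simpa using ha
    · have hb := hσ (j - 1) (by omega) (by omega)
      positivity

lemma SD_sub {k : ℤ} (α : ℝ) (lam : Fin n → ℝ) (p q : Fin n) (h : p ≠ q) :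
    SD α k lam q - SD α k lam p = (lam p - lam q) * SDD α k lam p q := by
  rw [SD_eq, SD_eq, SDD_eq]
  have hq : (some q) ∈ (Finset.univ : Finset (Option (Fin n))).erase (some p) := by
    simp [h.symm]
  have hp : (some p) ∈ (Finset.univ : Finset (Option (Fin n))).erase (some q) := by
    simp [h]
  rw [EE_erase hq, EE_erase hp, Finset.erase_right_comm (a := some q)]
  have h2 : k - 1 - 1 = k - 2 := by ring
  rw [h2]
  simp only [extv, Option.elim]
  ring

end Translate

/-- **Third-order terms estimate for `i = 1`** (Lemma 3.2): given `μ ∈ {1,…,k-1}`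
and `δ_μ ∈ (0,1]`, there are `ε, δ_{μ+1} > 0`, `m₀ ∈ ℕ` and `Λ > 0` such that for
all integers `m ≥ m₀` and all ordered `λ ∈ Γ̃_k` with `λ_n ≥ -K₀`,
`N₀ ≤ S_k(λ) ≤ N₁`, `λ_μ ≥ δ_μ λ₁`, `λ_{μ+1} ≤ δ_{μ+1} λ₁` and `λ₁ ≥ Λ`, and every
`ξ ∈ ℝⁿ`:
`(P_m²/m)[A₁+B₁+C₁+D₁−(1+ε/m)E₁] ≥ (1+ε)(S_k − κ₁ S_k^{11}) κ₁^{2m-3} ξ₁²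
  + 2 P_m Σ_{j≠1} S_k^{jj} Σ_{l=1}^{m-4} κ_j^l κ₁^{m-2-l} ξ_j²`.
(Indices are `1`-based in the informal statement; here `λ_j` is `lam ⟨j-1,_⟩`.) -/
theorem third_order_terms_index_one
    {n k : ℕ} (hk : 2 ≤ k) (hkn : k ≤ n) (α K₀ N₀ N₁ : ℝ)
    (hα : 0 < α) (hK₀ : 0 < K₀) (hN₀ : 0 < N₀) (hN₁ : 0 < N₁)
    (μ : ℕ) (hμ1 : 1 ≤ μ) (hμ2 : μ ≤ k - 1) (δμ : ℝ) (hδμ : 0 < δμ ∧ δμ ≤ 1) :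
    ∃ (ε δμ' : ℝ) (m₀ : ℕ) (Λ : ℝ), 0 < ε ∧ 0 < δμ' ∧ 0 < Λ ∧
      ∀ m : ℕ, m₀ ≤ m →
        ∀ lam ∈ GammaTilde n k α,
          (∀ i j : Fin n, i ≤ j → lam j ≤ lam i) →
          (∀ j : Fin n, -K₀ ≤ lam j) →
          N₀ ≤ Sfun α (k : ℤ) lam → Sfun α (k : ℤ) lam ≤ N₁ →
          δμ * lam ⟨0, by omega⟩ ≤ lam ⟨μ - 1, by omega⟩ →
          lam ⟨μ, by omega⟩ ≤ δμ' * lam ⟨0, by omega⟩ →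
          Λ ≤ lam ⟨0, by omega⟩ →
          ∀ ξ : Fin n → ℝ,
            ((Pm K₀ m lam) ^ 2 / (m : ℝ)) *
                (Aterm α K₀ (k : ℤ) m lam ξ ⟨0, by omega⟩
                  + Bterm α K₀ (k : ℤ) m lam ξ ⟨0, by omega⟩
                  + Cterm α K₀ (k : ℤ) m lam ξ ⟨0, by omega⟩
                  + Dterm α K₀ (k : ℤ) m lam ξ ⟨0, by omega⟩
                  - (1 + ε / (m : ℝ)) * Eterm α K₀ (k : ℤ) m lam ξ ⟨0, by omega⟩)
              ≥ (1 + ε) * (Sfun α (k : ℤ) lam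
                    - (lam ⟨0, by omega⟩ + K₀) * SD α (k : ℤ) lam ⟨0, by omega⟩)
                  * (lam ⟨0, by omega⟩ + K₀) ^ (2 * m - 3) * (ξ ⟨0, by omega⟩) ^ 2
                + 2 * Pm K₀ m lam *
                  ∑ j ∈ Finset.univ.erase (⟨0, by omega⟩ : Fin n), SD α (k : ℤ) lam j *
                    (∑ l ∈ Finset.Icc 1 (m - 4),
                      (lam j + K₀) ^ l * (lam ⟨0, by omega⟩ + K₀) ^ (m - 2 - l)) * (ξ j) ^ 2 := by
  have hn : 0 < n := by omega
  obtain ⟨hδ0, hδ1⟩ := hδμ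
  have hkR : (2 : ℝ) ≤ (k : ℝ) := by exact_mod_cast hk
  obtain ⟨N, hN⟩ : ∃ N : ℝ, N = (Fintype.card (Option (Fin n)) : ℝ) := ⟨_, rfl⟩
  have hN1 : 1 ≤ N := by rw [hN]; simp
  obtain ⟨c, hc⟩ : ∃ c : ℝ, c = 2 ^ (Fintype.card (Option (Fin n))) / δμ ^ μ := ⟨_, rfl⟩
  have hc1 : 1 ≤ c := by
    rw [hc, le_div_iff₀ (by positivity), one_mul]
    exact le_trans (pow_le_one₀ hδ0.le hδ1) (one_le_pow₀ (by norm_num))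
  obtain ⟨η, hη⟩ : ∃ η : ℝ, η = 1 / (24 * k * N * (4 * c)) := ⟨_, rfl⟩
  have hη0 : 0 < η := by rw [hη]; positivity
  have hkNc : 1 ≤ k * N := by nlinarith
  have hη_mul : η * (24 * k * N * (4 * c)) = 1 := by
    rw [hη]; field_simp
  have hcη : c * η ≤ 1 / 2 := by
    have : c * η * (96 * (k * N)) = 1 := by linarith
    have h0 : 0 < c * η := by positivity
    nlinarith
  have hη1 : η ≤ 1 := by nlinarith
  have hηs : 6 * (4 * c) * η * N ≤ 1 / (4 * (k : ℝ)) := by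
    rw [le_div_iff₀ (by positivity)]
    linarith
  obtain ⟨d, hd⟩ : ∃ d : ℝ, d = 1 / ((N + 1) * ((9 / η + 1) * (4 * c) * N)) := ⟨_, rfl⟩
  have hd0 : 0 < d := by rw [hd]; positivity
  obtain ⟨δ', hδ'⟩ : ∃ δ' : ℝ, δ' = min η d := ⟨_, rfl⟩
  have hδ'0 : 0 < δ' := by rw [hδ']; exact lt_min hη0 hd0
  have hδ'η : δ' ≤ η := by rw [hδ']; exact min_le_left _ _
  have hδ'd : δ' ≤ d := by rw [hδ']; exact min_le_right _ _
  have hM : (9 / η + 1) * (4 * c) * N ≤ 1 / ((N + 1) * δ') := by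
    rw [le_div_iff₀ (by positivity)]
    have hW : 0 < (N + 1) * ((9 / η + 1) * (4 * c) * N) := by positivity
    have : d * ((N + 1) * ((9 / η + 1) * (4 * c) * N)) = 1 := by
      rw [hd]; exact one_div_mul_cancel hW.ne'
    have h2 := mul_le_mul_of_nonneg_right hδ'd hW.le
    linarith
  refine ⟨1 / (4 * (k : ℝ)), δ', 4, K₀ / η + α / δ', by positivity, hδ'0, by positivity, ?_⟩
  intro m hm lam hlam hmono hlow hS0 _ hlμ hlμ' hΛ ξ
  have hcone := cone_of_GammaTilde (by omega) α hα lam hlam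
  set i0 : Fin n := ⟨0, by omega⟩ with hi0
  set L := lam i0 with hLdef
  have hL : 0 < L := lt_of_lt_of_le (by positivity) hΛ
  have hKL : K₀ ≤ η * L := by
    have h1 : K₀ / η ≤ L := le_trans (le_add_of_nonneg_right (by positivity)) hΛ
    rw [div_le_iff₀ hη0] at h1; linarith
  have hαL : α ≤ δ' * L := by
    have h1 : α / δ' ≤ L := le_trans (le_add_of_nonneg_left (by positivity)) hΛ
    rw [div_le_iff₀ hδ'0] at h1; linarith
  have hKL1 : K₀ ≤ L := by nlinarith
  have hδ'ηL : δ' * L ≤ η * L := mul_le_mul_of_nonneg_right hδ'η hL.le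
  have hmax : ∀ j, lam j ≤ L := fun j => hmono _ _ (by rw [hi0]; exact Nat.zero_le _)
  have hs : ∀ j, 0 ≤ SD α (k : ℤ) lam j := by
    intro j
    rw [SD_eq]
    exact (hcone.erase (Finset.mem_univ _)).nonneg le_rfl
  have ht : ∀ j, j ≠ i0 → 0 ≤ SDD α (k : ℤ) lam i0 j := by
    intro j hj
    rw [SDD_eq]
    exact ((hcone.erase (Finset.mem_univ _)).erase (by simp [hj])).nonneg (by omega)
  have hs1 : ∀ j, SD α (k : ℤ) lam i0 ≤ SD α (k : ℤ) lam j := by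
    intro j
    by_cases hj : j = i0
    · rw [hj]
    · have h1 := SD_sub (k := (k : ℤ)) α lam i0 j (fun h => hj h.symm)
      have h2 := mul_nonneg (sub_nonneg.mpr (hmax j)) (ht j hj)
      linarith
  have hκi : 0 < lam i0 + K₀ := by positivity
  let B : Finset (Option (Fin n)) :=
    (Finset.univ.filter (fun p : Fin n => p.val < μ)).map Function.Embedding.some
  have hBmem : ∀ p : Fin n, some p ∈ B ↔ p.val < μ := by
    intro p; simp [B]
  have hBnone : none ∉ B := by simp [B]
  have hBcard : B.card = μ := by
    simp only [B, Finset.card_map]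
    rw [Fin.card_filter_val_lt]
    omega
  have hsmall : ∀ v, v ∉ B → extv α lam v ≤ δ' * L := by
    intro v hv
    cases v with
    | none => exact hαL
    | some p =>
      rw [hBmem] at hv
      exact le_trans (hmono ⟨μ, by omega⟩ p (by rw [Fin.le_def]; simpa using hv)) hlμ'
  have hA := claim_A B (extv α lam) (extv 0 ξ) k μ hμ1 (by omega) hBcard (some i0)
    ((hBmem _).mpr (by simp [hi0]; omega)) δμ η δ' c L (lam i0 + K₀) hL hδ0 hδ1 hη0 hη1 hδ'0 hc
    (by
      intro v hv
      cases v with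
      | none => exact absurd hv hBnone
      | some p =>
        rw [hBmem] at hv
        refine ⟨le_trans hlμ (hmono p ⟨μ - 1, by omega⟩ ?_), hmax p⟩
        rw [Fin.le_def]; simp; omega)
    (by
      intro v hv
      rw [abs_le]
      refine ⟨?_, le_trans (hsmall v hv) hδ'ηL⟩
      cases v with
      | none =>
        have : 0 < extv α lam none := hα
        nlinarith
      | some p =>
        have : -K₀ ≤ extv α lam (some p) := hlow p
        linarith)
    hsmall hcη (by rw [← hN]; exact hηs) (by rw [← hN]; exact hM) rfl hκi (by linarith) hcone
  rw [EE1_eq, EE2_eq, ← Sfun_eq] at hA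
  have hsum : ∑ p ∈ Bᶜ, EE (Finset.univ.erase p) ((k : ℤ) - 1) (extv α lam) * extv 0 ξ p ^ 2
      ≤ ∑ j ∈ Finset.univ.erase i0, SD α (k : ℤ) lam j * ξ j ^ 2 := by
    have hsub : Bᶜ ⊆ insert none ((Finset.univ.erase i0).map Function.Embedding.some) := by
      intro v hv
      rw [Finset.mem_compl] at hv
      cases v with
      | none => simp
      | some p =>
        rw [hBmem] at hv
        have : p ≠ i0 := by
          rintro rfl
          apply hv; simp [hi0]; omega
        simp [this]
    refine le_trans (Finset.sum_le_sum_of_subset_of_nonneg hsub ?_) (le_of_eq ?_)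
    · intro v _ _
      exact mul_nonneg ((hcone.erase (Finset.mem_univ _)).nonneg le_rfl) (sq_nonneg _)
    · rw [Finset.sum_insert (by simp), Finset.sum_map]
      have h0 : extv 0 ξ none = 0 := rfl
      rw [h0]
      simp only [SD_eq]
      simp [extv]
  have hSpos : 0 < Sfun α (k : ℤ) lam := lt_of_lt_of_le hN₀ hS0
  have hX : (1 + 1 / (4 * (k : ℝ))) * Sfun α (k : ℤ) lam * (ξ i0 ^ 2 / (lam i0 + K₀) ^ 2)
      ≤ (2 * (∑ p, SD α k lam p * ξ p) ^ 2 / Sfun α k lam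
      - ∑ p, ∑ q ∈ Finset.univ.erase p, SDD α k lam p q * ξ p * ξ q)
        + 2 / (lam i0 + K₀) * ∑ j ∈ Finset.univ.erase i0, SD α (k : ℤ) lam j * ξ j ^ 2 := by
    have h1 : ξ i0 ^ 2 / (lam i0 + K₀) ^ 2 ≤ ξ i0 ^ 2 / L ^ 2 := by
      apply div_le_div_of_nonneg_left (sq_nonneg _) (by positivity)
      apply pow_le_pow_left₀ hL.le; linarith
    have h2 : (1 + 1 / (4 * (k : ℝ))) * Sfun α (k : ℤ) lam * (ξ i0 ^ 2 / (lam i0 + K₀) ^ 2)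
        ≤ (1 + 1 / (4 * (k : ℝ))) * Sfun α (k : ℤ) lam * (ξ i0 ^ 2 / L ^ 2) :=
      mul_le_mul_of_nonneg_left h1 (by positivity)
    have h3 := mul_le_mul_of_nonneg_left hsum (show 0 ≤ 2 / (lam i0 + K₀) by positivity)
    have h4 : extv 0 ξ (some i0) = ξ i0 := rfl
    rw [h4] at hA
    linarith
  exact algebra_final i0 (fun j => lam j + K₀) (fun j => SD α (k : ℤ) lam j)
    (fun j => SDD α (k : ℤ) lam i0 j) ξ (Sfun α (k : ℤ) lam) _ (1 / (4 * (k : ℝ))) m hm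
    (by positivity) (by rw [div_le_div_iff₀ (by positivity) (by norm_num)]; linarith) hκi
    (fun j => by linarith [hlow j]) (fun j => by linarith [hmax j]) hs hs1 ht hSpos.le hX
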